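/- arXiv:hep-th/0602248 — 2 statements merged into one kernel-verified Lean document; each statement's English description precedes it below -/
import Mathlib

section
/- Let ell >= 0 be an integer, q complex with |q| < 1, and a a complex number with a q^m != 1 for every integer m >= 1. Then sum over all partitions lambda of a^{2|lambda| - lambda_1} q^{C(2|lambda|+1,2) - 2|lambda| lambda_1 + 2 n(lambda') + |lambda| - (lambda_1 + ... + lambda_ell)} / ((aq;q)_{2|lambda|} b_{lambda'}(q)) equals (aq;q)_inf^{-1} sum_{i >= 0} ( a^{2i} q^{C(2i+1,2)} - a^{2i+2ell+1} q^{C(2i+2ell+2,2)} ) / (q;q)_i. Here lambda_1 + ... + lambda_ell denotes the sum of the first ell entries of lambda (with trailing zeros). -/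
open scoped BigOperators

noncomputable section

/-- Finite q-Pochhammer symbol `(a;q)_n`. -/
def qP (q a : ℂ) (n : ℕ) : ℂ := ∏ m ∈ Finset.range n, (1 - a * q ^ m)

/-- Infinite q-Pochhammer symbol `(a;q)_∞`. -/
def qPInf (q a : ℂ) : ℂ := ∏' m : ℕ, (1 - a * q ^ m)

/-- `C(n,2) = n(n-1)/2` for `n : ℤ` (exact integer division). -/
def ch2 (n : ℤ) : ℤ := n * (n - 1) / 2

/-- A partition: a weakly decreasing, finitely supported sequence of
nonnegative integers; `p i` is the part `λ_{i+1}` (0-indexed). -/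
structure Ptn where
  p : ℕ →₀ ℕ
  mono : ∀ ⦃i j : ℕ⦄, i ≤ j → p j ≤ p i

namespace Ptn

/-- The weight `|λ|`. -/
def wt (P : Ptn) : ℕ := P.p.sum fun _ v => v

/-- The entry `λ'_j` of the conjugate partition (here `j ≥ 1`). -/
def conj (P : Ptn) (j : ℕ) : ℕ := (P.p.support.filter fun i => j ≤ P.p i).card

/-- `n(λ') = Σ_{i≥1} (i-1) λ'_i`. -/
def nConj (P : Ptn) : ℕ := ∑ i ∈ Finset.range (P.p 0), i * P.conj (i + 1)

/-- `b_{λ'}(q) = Π_{i≥1} (q;q)_{m_i(λ')}`, using `m_i(λ') = λ_i - λ_{i+1}`. -/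
def bConj (q : ℂ) (P : Ptn) : ℂ := ∏ i ∈ P.p.support, qP q q (P.p i - P.p (i + 1))

/-- The sum of the first `ℓ` entries `λ_1 + ⋯ + λ_ℓ`. -/
def headSum (P : Ptn) (ℓ : ℕ) : ℕ := ∑ i ∈ Finset.range ℓ, P.p i

end Ptn

noncomputable section

/-- Gaussian binomial coefficients. -/
def gb (q : ℂ) : ℕ → ℕ → ℂ
  | _, 0 => 1
  | 0, _ + 1 => 0
  | n + 1, k + 1 => gb q n (k + 1) + q ^ (n - k) * gb q n k

lemma gb_zero (q : ℂ) (n : ℕ) : gb q n 0 = 1 := by cases n <;> simp [gb]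

lemma gb_succ (q : ℂ) (n k : ℕ) :
    gb q (n + 1) (k + 1) = gb q n (k + 1) + q ^ (n - k) * gb q n k := by simp [gb]

lemma gb_of_lt (q : ℂ) : ∀ (n k : ℕ), n < k → gb q n k = 0 := by
  intro n
  induction n with
  | zero => intro k hk; obtain ⟨k, rfl⟩ : ∃ j, k = j + 1 := ⟨k - 1, by omega⟩; simp [gb]
  | succ n ih =>
    intro k hk
    obtain ⟨k, rfl⟩ : ∃ j, k = j + 1 := ⟨k - 1, by omega⟩
    rw [gb_succ, ih _ (by omega), ih _ (by omega)]; simp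

lemma qP_zero (q a : ℂ) : qP q a 0 = 1 := by simp [qP]

lemma qP_succ (q a : ℂ) (n : ℕ) : qP q a (n + 1) = qP q a n * (1 - a * q ^ n) := by
  simp [qP, Finset.prod_range_succ]

lemma one_sub_pow_ne {q : ℂ} (hq : ‖q‖ < 1) (n : ℕ) : 1 - q ^ (n + 1) ≠ 0 := by
  intro h
  have h1 : ‖q ^ (n + 1)‖ = 1 := by rw [← sub_eq_zero.mp h]; simp
  rw [norm_pow] at h1
  have := pow_lt_one₀ (norm_nonneg q) hq (Nat.succ_ne_zero n)
  simp at this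
  linarith

lemma qq_ne {q : ℂ} (hq : ‖q‖ < 1) (n : ℕ) : qP q q n ≠ 0 := by
  rw [qP, Finset.prod_ne_zero_iff]
  intro m _
  have := one_sub_pow_ne hq m
  rwa [pow_succ'] at this

lemma gb_eq (q : ℂ) : ∀ (n j k : ℕ), j + k = n → gb q n k * (qP q q k * qP q q j) = qP q q n := by
  intro n
  induction n with
  | zero => 
    intro j k h
    obtain ⟨rfl, rfl⟩ : j = 0 ∧ k = 0 := by omega
    simp [gb, qP_zero]
  | succ n ih =>
    intro j k h
    rcases k with _ | k
    · simp only [add_zero] at h; subst h; simp [gb_zero, qP_zero]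
    rcases j with _ | j
    · have hk : k = n := by omega
      subst hk
      rw [gb_succ, gb_of_lt q _ _ (Nat.lt_succ_self k)]
      have := ih 0 k (by omega)
      simp only [qP_zero, mul_one, qP_succ] at this ⊢
      rw [← mul_assoc]; simp [this]
    · have h1 := ih j (k + 1) (by omega)
      have h2 := ih (j + 1) k (by omega)
      have hn : n = j + k + 1 := by omega
      subst hn
      rw [gb_succ]
      have e : j + k + 1 - k = j + 1 := by omega
      rw [e]
      rw [qP_succ q q k] at h1 ⊢
      rw [qP_succ q q j] at h2 ⊢
      rw [qP_succ q q (j + k + 1)]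
      linear_combination (1 - q * q ^ j) * h1 + q ^ (j + 1) * (1 - q * q ^ k) * h2

lemma gb_div {q : ℂ} (hq : ‖q‖ < 1) (j k : ℕ) :
    (qP q q k)⁻¹ * (qP q q j)⁻¹ = gb q (j + k) k * (qP q q (j + k))⁻¹ := by
  have := gb_eq q (j + k) j k rfl
  have h1 := qq_ne hq j
  have h2 := qq_ne hq k
  have h3 := qq_ne hq (j + k)
  field_simp
  linear_combination -this

open PowerSeries PowerSeries.WithPiTopology

/-- Pochhammer product in the ring of power series. -/
def gP (q : ℂ) (y : ℂ⟦X⟧) (n : ℕ) : ℂ⟦X⟧ := ∏ m ∈ Finset.range n, (1 - y * C (q ^ m))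

lemma gP_zero (q : ℂ) (y : ℂ⟦X⟧) : gP q y 0 = 1 := by simp [gP]

lemma gP_succ (q : ℂ) (y : ℂ⟦X⟧) (n : ℕ) :
    gP q y (n + 1) = gP q y n * (1 - y * C (q ^ n)) := by
  simp [gP, Finset.prod_range_succ]

lemma gP_succ' (q : ℂ) (y : ℂ⟦X⟧) (n : ℕ) :
    gP q y (n + 1) = (1 - y) * gP q (y * C q) n := by
  simp only [gP, Finset.prod_range_succ']
  rw [mul_comm]
  simp [pow_succ', mul_assoc]

lemma gP_add (q : ℂ) (y : ℂ⟦X⟧) (m n : ℕ) :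
    gP q y (m + n) = gP q y m * gP q (y * C (q ^ m)) n := by
  simp only [gP, Finset.prod_range_add]
  simp [pow_add, mul_assoc]

lemma cc_gP (q : ℂ) {y : ℂ⟦X⟧} (hy : X ∣ y) (n : ℕ) : constantCoeff (gP q y n) = 1 := by
  have : constantCoeff y = 0 := X_dvd_iff.mp hy
  simp [gP, map_prod, this]

lemma gP_inv (q : ℂ) {y : ℂ⟦X⟧} (hy : X ∣ y) (n : ℕ) : gP q y n * (gP q y n)⁻¹ = 1 :=
  PowerSeries.mul_inv_cancel _ (by simp [cc_gP q hy])

lemma gP_ne (q : ℂ) {y : ℂ⟦X⟧} (hy : X ∣ y) (n : ℕ) : gP q y n ≠ 0 := by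
  intro h; have := gP_inv q hy n; simp [h] at this

/-- Finite q-binomial theorem. -/
lemma qbinom (q : ℂ) (y : ℂ⟦X⟧) (n : ℕ) :
    ∑ k ∈ Finset.range (n + 1), C (gb q n k * q ^ (k.choose 2)) * (-y) ^ k = gP q y n := by
  induction n with
  | zero => simp [gb_zero, gP_zero]
  | succ n ih =>
    rw [Finset.sum_range_succ', gP_succ, ← ih]
    have h0 : ∑ k ∈ Finset.range (n + 1), C (gb q n (k + 1) * q ^ ((k + 1).choose 2)) * (-y) ^ (k + 1)
        + 1 = ∑ k ∈ Finset.range (n + 1), C (gb q n k * q ^ (k.choose 2)) * (-y) ^ k := by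
      have := Finset.sum_range_succ' (fun k => C (gb q n k * q ^ (k.choose 2)) * (-y) ^ k) (n + 1)
      rw [Finset.sum_range_succ, gb_of_lt q n (n + 1) (by omega)] at this
      simp [gb_zero] at this ⊢
      rw [this]
    have h1 : ∀ k ∈ Finset.range (n + 1),
        C (gb q (n + 1) (k + 1) * q ^ ((k + 1).choose 2)) * (-y) ^ (k + 1) =
        C (gb q n (k + 1) * q ^ ((k + 1).choose 2)) * (-y) ^ (k + 1)
        - y * C (q ^ n) * (C (gb q n k * q ^ (k.choose 2)) * (-y) ^ k) := by
      intro k hk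
      have hk : k ≤ n := by simpa [Nat.lt_succ_iff] using hk
      have hc : (k + 1).choose 2 = k + k.choose 2 := by
        rw [Nat.choose_succ_succ' k 1]; simp
      have e : q ^ n = q ^ (n - k) * q ^ k := by rw [← pow_add]; congr 1; omega
      rw [gb_succ, hc, e]
      simp only [map_mul, map_add, map_pow, pow_add]
      ring
    rw [Finset.sum_congr rfl h1, Finset.sum_sub_distrib, ← Finset.mul_sum]
    simp only [gb_zero, Nat.choose_zero_succ, pow_zero, mul_one, map_one]
    linear_combination h0

/-- q-Chu-Vandermonde, polynomial form. -/
lemma qvand_poly (q : ℂ) (n : ℕ) : ∀ (x : ℂ⟦X⟧),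
    ∑ s ∈ Finset.range (n + 1), C (gb q n s * q ^ (s * (s - 1))) * x ^ s *
      gP q (x * C (q ^ s)) (n - s) = 1 := by
  induction n with
  | zero => intro x; simp [gb_zero, gP_zero]
  | succ n ih =>
    intro x
    have ih1 := ih x
    have ih2 := ih (x * C q)
    rw [Finset.sum_range_succ']
    have h0 : ∑ k ∈ Finset.range (n + 1), C (gb q n (k + 1) * q ^ ((k + 1) * k)) * x ^ (k + 1)
        * gP q (x * C (q ^ (k + 1))) (n - (k + 1))
        + gP q x n = 1 := by
      have := Finset.sum_range_succ' (fun s => C (gb q n s * q ^ (s * (s - 1))) * x ^ s *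
      gP q (x * C (q ^ s)) (n - s)) (n + 1)
      rw [Finset.sum_range_succ, gb_of_lt q n (n + 1) (by omega), ih1] at this
      simp [gb_zero] at this ⊢
      rw [← this]
    have h1 : ∀ k ∈ Finset.range (n + 1),
        C (gb q (n + 1) (k + 1) * q ^ ((k + 1) * (k + 1 - 1))) * x ^ (k + 1) *
      gP q (x * C (q ^ (k + 1))) (n + 1 - (k + 1)) =
        (1 - x * C (q ^ n)) * (C (gb q n (k + 1) * q ^ ((k + 1) * k)) * x ^ (k + 1)
        * gP q (x * C (q ^ (k + 1))) (n - (k + 1)))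
        + x * C (q ^ n) * (C (gb q n k * q ^ (k * (k - 1))) * (x * C q) ^ k
          * gP q (x * C q * C (q ^ k)) (n - k)) := by
      intro k hk
      have hk : k ≤ n := by simpa [Nat.lt_succ_iff] using hk
      have e : q ^ n = q ^ (n - k) * q ^ k := by rw [← pow_add]; congr 1; omega
      have e2 : q ^ ((k + 1) * (k + 1 - 1)) = q ^ (k * (k - 1)) * q ^ k * q ^ k := by
        rw [← pow_add, ← pow_add]; congr 1
        rcases k with _ | k
        · simp
        · simp; ring
      have e3 : x * C q * C (q ^ k) = x * C (q ^ (k + 1)) := by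
        rw [mul_assoc, ← map_mul, pow_succ']
      have e4 : n + 1 - (k + 1) = n - k := by omega
      have e5 : (k + 1) * k = (k + 1) * (k + 1 - 1) := by simp
      rw [e3, e4, e5, gb_succ]
      rcases Nat.lt_or_ge k n with h | h
      · obtain ⟨m, rfl⟩ : ∃ m, n = k + 1 + m := ⟨n - (k + 1), by omega⟩
        have e6 : k + 1 + m - k = m + 1 := by omega
        have e7 : k + 1 + m - (k + 1) = m := by omega
        rw [e6, e7, gP_succ, e2]
        rw [e6] at e
        simp only [map_mul, map_add, map_pow, pow_add, mul_pow]
        ring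
      · have : k = n := by omega
        subst this
        rw [gb_of_lt q k (k + 1) (by omega), e2]
        simp only [map_mul, map_add, map_pow, pow_add, mul_pow, map_zero]
        simp
        ring
    rw [Finset.sum_congr rfl h1, Finset.sum_add_distrib, ← Finset.mul_sum, ← Finset.mul_sum, ih2]
    simp only [gb_zero, pow_zero, mul_one, map_one, zero_mul, one_mul, Nat.sub_zero]
    rw [gP_succ]
    linear_combination (1 - x * C (q ^ n)) * h0

lemma qvand {q : ℂ} (hq : ‖q‖ < 1) {x : ℂ⟦X⟧} (hx : X ∣ x) (n : ℕ) :
    ∑ s ∈ Finset.range (n + 1), C (q ^ (s * (s - 1)) * (qP q q (n - s))⁻¹) * x ^ s *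
      (C (qP q q s)⁻¹ * (gP q x s)⁻¹) = C (qP q q n)⁻¹ * (gP q x n)⁻¹ := by
  have h := qvand_poly q n x
  have h2 := congrArg (fun t => C (qP q q n)⁻¹ * (gP q x n)⁻¹ * t) h
  simp only [mul_one, Finset.mul_sum] at h2
  rw [← h2]
  apply Finset.sum_congr rfl
  intro s hs
  have hs : s ≤ n := by simpa [Nat.lt_succ_iff] using hs
  obtain ⟨m, rfl⟩ : ∃ m, n = m + s := ⟨n - s, by omega⟩
  have e := gb_div hq m s
  rw [Nat.add_sub_cancel]
  have e2 : (gP q x s)⁻¹ = (gP q x (m + s))⁻¹ * gP q (x * C (q ^ s)) m := by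
    have a1 := gP_inv q hx s
    have a2 := gP_inv q hx (m + s)
    have a3 := gP_add q x s m
    rw [add_comm] at a3
    rw [a3] at a2 ⊢
    apply mul_left_cancel₀ (gP_ne q hx s)
    rw [a1]; linear_combination -a2
  rw [e2]
  have e' := congrArg (C (R := ℂ)) e
  simp only [map_mul] at e' ⊢
  linear_combination C (q ^ (s * (s - 1))) * x ^ s * ((gP q x (m + s))⁻¹ * gP q (x * C (q ^ s)) m) * e'

end

noncomputable section
open PowerSeries PowerSeries.WithPiTopology

lemma ps_summable {ι : Type*} (f : ι → ℂ⟦X⟧) (d : ι → ℕ) (hd : ∀ N, {i | d i ≤ N}.Finite)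
    (hf : ∀ i, X ^ (d i) ∣ f i) : Summable f := by
  rw [summable_iff_summable_coeff]
  intro N
  apply summable_of_hasFiniteSupport
  refine (hd N).subset ?_
  intro i hi
  by_contra h
  simp only [Set.mem_ofPred_eq, not_le] at h
  exact hi (X_pow_dvd_iff.mp (hf i) N h)

lemma dvd_tsum {ι : Type*} {f : ι → ℂ⟦X⟧} (hs : Summable f) {n : ℕ} (h : ∀ i, X ^ n ∣ f i) :
    X ^ n ∣ ∑' i, f i := by
  rw [X_pow_dvd_iff]
  intro m hm
  have h1 := (hasSum_iff_hasSum_coeff ℂ).mp hs.hasSum m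
  rw [← h1.tsum_eq]
  simp_rw [fun i => X_pow_dvd_iff.mp (h i) m hm]
  simp

lemma fin_le1 (N : ℕ) : {i : ℕ | i ≤ N}.Finite := Set.finite_Iic N

lemma fin_le2 (N : ℕ) : {i : ℕ × ℕ | i.1 + i.2 ≤ N}.Finite := by
  refine ((Set.finite_Iic N).prod (Set.finite_Iic N)).subset ?_
  rintro ⟨a, b⟩ h
  simp only [Set.mem_ofPred_eq] at h
  simp only [Set.mem_prod, Set.mem_Iic]
  omega

lemma fin_le3 (N : ℕ) : {i : ℕ × ℕ × ℕ | i.1 + i.2.1 + i.2.2 ≤ N}.Finite := by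
  refine ((Set.finite_Iic N).prod ((Set.finite_Iic N).prod (Set.finite_Iic N))).subset ?_
  rintro ⟨a, b, c⟩ h
  simp only [Set.mem_ofPred_eq] at h
  simp only [Set.mem_prod, Set.mem_Iic]
  omega

/-- `1/(y;q)_∞` as formal series. -/
def EE (q : ℂ) (y : ℂ⟦X⟧) : ℂ⟦X⟧ := ∑' k : ℕ, C (qP q q k)⁻¹ * y ^ k

/-- `(y;q)_∞` as formal series. -/
def ee (q : ℂ) (y : ℂ⟦X⟧) : ℂ⟦X⟧ := ∑' k : ℕ, C (q ^ (k.choose 2) * (qP q q k)⁻¹) * (-y) ^ k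

lemma sum_pow {y : ℂ⟦X⟧} (hy : X ∣ y) (c : ℕ → ℂ) : Summable fun k => C (c k) * y ^ k :=
  ps_summable _ id fin_le1 fun i => (pow_dvd_pow_of_dvd hy i).mul_left _

lemma EE_mul {q : ℂ} (hq : ‖q‖ < 1) {y : ℂ⟦X⟧} (hy : X ∣ y) :
    EE q (y * C q) = (1 - y) * EE q y := by
  have h1 := sum_pow hy (fun k => (qP q q k)⁻¹)
  have h2 := sum_pow (hy.mul_right (C q)) (fun k => (qP q q k)⁻¹)
  have key : EE q y - EE q (y * C q) = y * EE q y := by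
    unfold EE
    rw [← h1.tsum_sub h2, (h1.sub h2).tsum_eq_zero_add, ← h1.tsum_mul_left]
    simp only [pow_zero, sub_self, zero_add]
    congr 1; ext1 k
    rw [qP_succ]
    have a := one_sub_pow_ne hq k
    rw [pow_succ'] at a
    have b := qq_ne hq k
    have : (qP q q k * (1 - q * q ^ k))⁻¹ * (1 - q * q ^ k) = (qP q q k)⁻¹ := by field_simp
    have := congrArg (C (R := ℂ)) this
    simp only [map_mul, map_sub, map_pow, map_one] at this
    rw [mul_pow]
    linear_combination y ^ (k + 1) * this
  linear_combination -key

lemma EE_mul_pow {q : ℂ} (hq : ‖q‖ < 1) {y : ℂ⟦X⟧} (hy : X ∣ y) (n : ℕ) :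
    EE q (y * C (q ^ n)) = gP q y n * EE q y := by
  induction n with
  | zero => simp [gP_zero]
  | succ n ih =>
    rw [pow_succ, map_mul, ← mul_assoc, EE_mul hq (hy.mul_right _), ih, gP_succ]
    ring

lemma ee_mul {q : ℂ} (hq : ‖q‖ < 1) {y : ℂ⟦X⟧} (hy : X ∣ y) :
    ee q y = (1 - y) * ee q (y * C q) := by
  have h1 := sum_pow (dvd_neg.mpr hy) (fun k => q ^ (k.choose 2) * (qP q q k)⁻¹)
  have h2 := sum_pow (dvd_neg.mpr (hy.mul_right (C q))) (fun k => q ^ (k.choose 2) * (qP q q k)⁻¹)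
  have key : ee q y - ee q (y * C q) = -y * ee q (y * C q) := by
    unfold ee
    rw [← h1.tsum_sub h2, (h1.sub h2).tsum_eq_zero_add, ← h2.tsum_mul_left]
    simp only [pow_zero, sub_self, zero_add]
    congr 1; ext1 k
    rw [qP_succ]
    have a := one_sub_pow_ne hq k
    rw [pow_succ'] at a
    have b := qq_ne hq k
    have hc : (k + 1).choose 2 = k + k.choose 2 := by
      rw [Nat.choose_succ_succ' k 1]; simp
    have : (qP q q k * (1 - q * q ^ k))⁻¹ * (1 - q * q ^ k) = (qP q q k)⁻¹ := by field_simp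
    have := congrArg (C (R := ℂ)) this
    simp only [map_mul, map_sub, map_pow, map_one] at this
    rw [hc, ← neg_mul, mul_pow]
    simp only [map_mul, map_pow, pow_add]
    linear_combination (-y) ^ (k + 1) * C q ^ k * C q ^ (k.choose 2) * this
  linear_combination key

lemma ee_mul_pow {q : ℂ} (hq : ‖q‖ < 1) {y : ℂ⟦X⟧} (hy : X ∣ y) (n : ℕ) :
    ee q y = gP q y n * ee q (y * C (q ^ n)) := by
  induction n with
  | zero => simp [gP_zero]
  | succ n ih =>
    rw [ih, ee_mul hq (hy.mul_right (C (q ^ n))), gP_succ, pow_succ, map_mul, mul_assoc y]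
    ring

lemma qbinom_div {q : ℂ} (hq : ‖q‖ < 1) (y : ℂ⟦X⟧) (n : ℕ) :
    ∑ p ∈ Finset.HasAntidiagonal.antidiagonal n, C ((qP q q p.1)⁻¹ * (q ^ (p.2.choose 2) * (qP q q p.2)⁻¹))
      * (-y) ^ p.2 = C (qP q q n)⁻¹ * gP q y n := by
  rw [Finset.Nat.antidiagonal_eq_map', Finset.sum_map, ← qbinom, Finset.mul_sum]
  apply Finset.sum_congr rfl
  intro k hk
  have hk : k ≤ n := by simpa [Nat.lt_succ_iff] using hk
  obtain ⟨m, rfl⟩ : ∃ m, n = m + k := ⟨n - k, by omega⟩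
  have e := congrArg (C (R := ℂ)) (gb_div hq m k)
  change C ((qP q q (m + k - k))⁻¹ * (q ^ (k.choose 2) * (qP q q k)⁻¹)) * (-y) ^ k = _
  rw [Nat.add_sub_cancel]
  simp only [map_mul] at e ⊢
  linear_combination C (q ^ (k.choose 2)) * (-y) ^ k * e

lemma EE_ee {q : ℂ} (hq : ‖q‖ < 1) {y : ℂ⟦X⟧} (hy : X ∣ y) : EE q y * ee q y = 1 := by
  unfold EE ee
  have hy' := dvd_neg.mpr hy
  rw [Summable.tsum_mul_tsum_eq_tsum_sum_antidiagonal (sum_pow hy _) (sum_pow hy' _)]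
  · rw [tsum_eq_single 0]
    · simp [qP_zero]
    · intro n hn
      have h := qbinom_div hq 1 n
      obtain ⟨m, rfl⟩ : ∃ m, n = m + 1 := ⟨n - 1, by omega⟩
      rw [gP_succ'] at h
      simp only [sub_self, zero_mul, mul_zero] at h
      have h2 := congrArg (fun t => t * y ^ (m + 1)) h
      simp only [zero_mul, Finset.sum_mul] at h2
      rw [← h2]
      apply Finset.sum_congr rfl
      intro p hp
      rw [← Finset.HasAntidiagonal.mem_antidiagonal.mp hp, pow_add, neg_pow y]
      simp only [map_mul]
      ring
  · refine ps_summable _ (fun p => p.1 + p.2) fin_le2 ?_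
    intro p
    rw [pow_add]
    exact mul_dvd_mul ((pow_dvd_pow_of_dvd hy _).mul_left _) ((pow_dvd_pow_of_dvd hy' _).mul_left _)

/-- the basic hypergeometric sum -/
lemma phi11 {q : ℂ} (hq : ‖q‖ < 1) {z : ℂ⟦X⟧} (hz : X ∣ z) :
    ∑' r : ℕ, C (q ^ (r.choose 2)) * z ^ r * EE q (-z * C (q ^ r)) *
      (C (qP q q r)⁻¹ * (gP q (z ^ 2) r)⁻¹) = EE q (z ^ 2) := by
  have hz2 : X ∣ z ^ 2 := dvd_pow hz two_ne_zero
  have hnz : X ∣ -z := dvd_neg.mpr hz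
  -- the summand
  set F : ℕ → ℕ × ℕ → ℂ⟦X⟧ := fun r p =>
    (C (q ^ (r.choose 2) * (qP q q r)⁻¹) * z ^ r) *
      ((C (qP q q p.1)⁻¹ * (-z * C (q ^ r)) ^ p.1) *
      (C (q ^ (p.2.choose 2) * (qP q q p.2)⁻¹) * (-(z ^ 2 * C (q ^ r))) ^ p.2)) with hF
  have hFd : ∀ r p, X ^ (r + p.1 + p.2) ∣ F r p := by
    intro r p
    rw [hF, add_assoc, pow_add X r, pow_add X p.1]
    exact mul_dvd_mul ((pow_dvd_pow_of_dvd hz _).mul_left _)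
      (mul_dvd_mul ((pow_dvd_pow_of_dvd (hnz.mul_right _) _).mul_left _)
      ((pow_dvd_pow_of_dvd (dvd_neg.mpr (hz2.mul_right _)) _).mul_left _))
  have hFs : Summable (Function.uncurry F) :=
    ps_summable _ (fun t => t.1 + t.2.1 + t.2.2) fin_le3 fun t => hFd t.1 t.2
  have hFs1 : ∀ r, Summable (F r) := fun r =>
    ps_summable _ (fun t => t.1 + t.2) fin_le2
      fun t => (pow_dvd_pow X (by omega)).trans (hFd r t)
  have hFs2 : ∀ p, Summable fun r => F r p := fun p =>
    ps_summable _ id fin_le1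
      fun t => (pow_dvd_pow X (by simp only [id]; omega)).trans (hFd t p)
  have step1 : ∀ r : ℕ, C (q ^ (r.choose 2)) * z ^ r * EE q (-z * C (q ^ r)) *
      (C (qP q q r)⁻¹ * (gP q (z ^ 2) r)⁻¹) = EE q (z ^ 2) * ∑' p, F r p := by
    intro r
    have h1 : ∑' p, F r p = (C (q ^ (r.choose 2) * (qP q q r)⁻¹) * z ^ r) *
        (EE q (-z * C (q ^ r)) * ee q (z ^ 2 * C (q ^ r))) := by
      rw [hF]
      unfold EE ee
      have hs : Summable fun p : ℕ × ℕ => (C (qP q q p.1)⁻¹ * (-z * C (q ^ r)) ^ p.1) *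
          (C (q ^ (p.2.choose 2) * (qP q q p.2)⁻¹) * (-(z ^ 2 * C (q ^ r))) ^ p.2) := by
        refine ps_summable _ (fun p => p.1 + p.2) fin_le2 ?_
        intro p
        rw [pow_add]
        exact (mul_dvd_mul ((pow_dvd_pow_of_dvd (hnz.mul_right _) _).mul_left _)
          ((pow_dvd_pow_of_dvd (dvd_neg.mpr (hz2.mul_right _)) _).mul_left _))
      rw [hs.tsum_mul_left, Summable.tsum_mul_tsum]
      · exact sum_pow (hnz.mul_right _) _
      · exact sum_pow (dvd_neg.mpr (hz2.mul_right _)) _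
      · exact hs
    have h2 := ee_mul_pow hq hz2 r
    have h3 := EE_ee hq hz2
    have h4 := gP_inv q hz2 r
    have h5 : (gP q (z ^ 2) r)⁻¹ = EE q (z ^ 2) * ee q (z ^ 2 * C (q ^ r)) := by
      apply mul_left_cancel₀ (gP_ne q hz2 r)
      rw [h4, ← h3, h2]; ring
    rw [h1, h5, map_mul]; ring
  have step2 : ∀ p : ℕ × ℕ, ∑' r, F r p = (C (qP q q p.1)⁻¹ * (-z) ^ p.1) *
      (C (q ^ (p.2.choose 2) * (qP q q p.2)⁻¹) * (-(z ^ 2)) ^ p.2) *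
      (ee q (-z) * (gP q (-z) (p.1 + p.2))⁻¹) := by
    intro p
    have h1 : ee q (-z) * (gP q (-z) (p.1 + p.2))⁻¹ = ee q (-z * C (q ^ (p.1 + p.2))) := by
      apply mul_left_cancel₀ (gP_ne q hnz (p.1 + p.2))
      rw [← ee_mul_pow hq hnz]
      have := gP_inv q hnz (p.1 + p.2)
      linear_combination ee q (-z) * this
    rw [h1, ee, ← (sum_pow (dvd_neg.mpr (hnz.mul_right (C (q ^ (p.1 + p.2)))))
      (fun k => q ^ (k.choose 2) * (qP q q k)⁻¹)).tsum_mul_left]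
    congr 1; ext1 r
    rw [hF]
    have e : (-(-z * C (q ^ (p.1 + p.2)))) ^ r = z ^ r * (C (q ^ r) ^ p.1 * C (q ^ r) ^ p.2) := by
      rw [neg_mul, neg_neg, mul_pow, ← map_pow, ← map_pow, ← map_pow, ← map_mul]
      congr 2; ring
    simp only
    rw [e, mul_pow, ← neg_mul, mul_pow]
    ring
  have step3 : ∑' p, ∑' r, F r p = 1 := by
    simp_rw [step2]
    have hs : Summable fun p : ℕ × ℕ => (C (qP q q p.1)⁻¹ * (-z) ^ p.1) *
      (C (q ^ (p.2.choose 2) * (qP q q p.2)⁻¹) * (-(z ^ 2)) ^ p.2) *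
      (ee q (-z) * (gP q (-z) (p.1 + p.2))⁻¹) := by
      refine ps_summable _ (fun p => p.1 + p.2) fin_le2 ?_
      intro p
      rw [pow_add]
      exact (mul_dvd_mul ((pow_dvd_pow_of_dvd hnz _).mul_left _)
          ((pow_dvd_pow_of_dvd (dvd_neg.mpr hz2) _).mul_left _)).mul_right _
    rw [← Finset.HasAntidiagonal.sigmaAntidiagonalEquivProd.tsum_eq, Summable.tsum_sigma']
    · rw [← EE_ee hq hnz, EE, ← (sum_pow hnz (fun k => (qP q q k)⁻¹)).tsum_mul_right]
      congr 1; ext1 n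
      rw [tsum_fintype]
      have h := qbinom_div hq (-z) n
      have hg := gP_inv q hnz n
      have h3 : C (qP q q n)⁻¹ = ∑ p ∈ Finset.HasAntidiagonal.antidiagonal n, C ((qP q q p.1)⁻¹ * (q ^ (p.2.choose 2) * (qP q q p.2)⁻¹))
      * (-(-z)) ^ p.2 * (gP q (-z) n)⁻¹ := by
        rw [← Finset.sum_mul, h]; linear_combination -C (qP q q n)⁻¹ * hg
      rw [h3, Finset.sum_mul, Finset.sum_mul, ← Finset.sum_coe_sort (Finset.HasAntidiagonal.antidiagonal n)]
      apply Finset.sum_congr rfl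
      rintro ⟨p, hp⟩ -
      have hp := Finset.HasAntidiagonal.mem_antidiagonal.mp hp
      simp only [Finset.HasAntidiagonal.sigmaAntidiagonalEquivProd_apply]
      subst hp
      have : (-(z ^ 2)) ^ p.2 = z ^ p.2 * (-z) ^ p.2 := by rw [← mul_pow]; congr 1; ring
      rw [this, neg_neg, pow_add]
      simp only [map_mul]
      ring
    · intro b; exact Summable.of_finite
    · exact (Finset.HasAntidiagonal.sigmaAntidiagonalEquivProd.summable_iff).mpr hs
  simp_rw [step1]
  have hs4 : Summable fun r => ∑' p, F r p := by
    refine ps_summable _ id fin_le1 ?_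
    intro r
    exact dvd_tsum (hFs1 r) fun p => (pow_dvd_pow X (by simp only [id]; omega)).trans (hFd r p)
  rw [hs4.tsum_mul_left, ← Summable.tsum_comm' hFs hFs1 hFs2, step3, mul_one]

/-- The basic functions `G_ℓ(r)`. -/
def GG (q : ℂ) (ℓ r : ℕ) : ℂ⟦X⟧ :=
  C (qP q q r)⁻¹ * (gP q (X ^ 2) r)⁻¹ -
    X ^ (2 * ℓ) * C ((1 - q ^ r) * (qP q q r)⁻¹) * (gP q (X ^ 2) (r + 1))⁻¹

lemma phi_GG {q : ℂ} (hq : ‖q‖ < 1) (ℓ : ℕ) :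
    ∑' r : ℕ, C (q ^ (r.choose 2)) * X ^ r * EE q (-X * C (q ^ r)) * GG q ℓ r
      = (1 - X ^ (2 * ℓ + 1)) * EE q (X ^ 2) := by
  have hX : (X : ℂ⟦X⟧) ∣ X := dvd_rfl
  have hX2 : (X : ℂ⟦X⟧) ∣ X ^ 2 := dvd_pow hX two_ne_zero
  set f1 : ℕ → ℂ⟦X⟧ := fun r => C (q ^ (r.choose 2)) * X ^ r * EE q (-X * C (q ^ r)) *
      (C (qP q q r)⁻¹ * (gP q (X ^ 2) r)⁻¹) with hf1
  set f2 : ℕ → ℂ⟦X⟧ := fun r => C (q ^ (r.choose 2)) * X ^ r * EE q (-X * C (q ^ r)) *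
      (C ((1 - q ^ r) * (qP q q r)⁻¹) * (gP q (X ^ 2) (r + 1))⁻¹) with hf2
  have s1 : Summable f1 := ps_summable _ id fin_le1 fun i =>
    (((dvd_refl (X ^ i)).mul_left _).mul_right _).mul_right _
  have s2 : Summable f2 := ps_summable _ id fin_le1 fun i =>
    (((dvd_refl (X ^ i)).mul_left _).mul_right _).mul_right _
  have t1 : ∑' r, f1 r = EE q (X ^ 2) := phi11 hq hX
  have t2 : ∑' r, f2 r = X * EE q (X ^ 2) := by
    have hXq : X ∣ X * C q := hX.mul_right _
    have h := phi11 hq hXq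
    have e1 : (X * C q) ^ 2 = X ^ 2 * C (q ^ 2) := by rw [mul_pow, map_pow]
    rw [e1, EE_mul_pow hq hX2] at h
    rw [s2.tsum_eq_zero_add]
    have : f2 0 = 0 := by simp [hf2]
    rw [this, zero_add]
    have s3 : Summable fun r => C (q ^ (r.choose 2)) * (X * C q) ^ r * EE q (-(X * C q) * C (q ^ r)) *
        (C (qP q q r)⁻¹ * (gP q (X ^ 2 * C (q ^ 2)) r)⁻¹) := ps_summable _ id fin_le1 fun i =>
      (((pow_dvd_pow_of_dvd hXq i).mul_left _).mul_right _).mul_right _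
    have h2 : EE q (X ^ 2) = (gP q (X ^ 2) 2)⁻¹ * (gP q (X ^ 2) 2 * EE q (X ^ 2)) := by
      have := gP_inv q hX2 2
      linear_combination -EE q (X ^ 2) * this
    rw [h2, ← h, ← s3.tsum_mul_left, ← (s3.mul_left _).tsum_mul_left]
    congr 1; ext1 r
    rw [hf2]
    have a := one_sub_pow_ne hq r
    have b := qq_ne hq r
    have hc : (r + 1).choose 2 = r + r.choose 2 := by
      rw [Nat.choose_succ_succ' r 1]; simp
    have e2 : (1 - q ^ (r + 1)) * (qP q q (r + 1))⁻¹ = (qP q q r)⁻¹ := by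
      rw [qP_succ, ← pow_succ']; field_simp
    have e3 : (gP q (X ^ 2) (r + 1 + 1))⁻¹ = (gP q (X ^ 2) 2)⁻¹ * (gP q (X ^ 2 * C (q ^ 2)) r)⁻¹ := by
      rw [add_assoc, add_comm r, gP_add, PowerSeries.mul_inv_rev, mul_comm]
    have e4 : -(X * C q) * C (q ^ r) = -X * C (q ^ (r + 1)) := by
      rw [pow_succ', map_mul]; ring
    simp only
    rw [e2, e3, e4, hc]
    simp only [map_mul, map_pow, pow_add, mul_pow]
    ring
  have : ∀ r : ℕ, C (q ^ (r.choose 2)) * X ^ r * EE q (-X * C (q ^ r)) * GG q ℓ r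
      = f1 r - X ^ (2 * ℓ) * f2 r := by
    intro r; rw [hf1, hf2, GG]; ring
  simp_rw [this]
  rw [s1.tsum_sub (s2.mul_left _), s2.tsum_mul_left, t1, t2, pow_succ]
  ring

end

noncomputable section
open PowerSeries PowerSeries.WithPiTopology

namespace Ptn

lemma ext' {P Q : Ptn} (h : ∀ i, P.p i = Q.p i) : P = Q := by
  cases P; cases Q
  congr
  ext i
  exact h i

/-- Remove the first part. -/
def tail (P : Ptn) : Ptn where
  p := Finsupp.comapDomain Nat.succ P.p Nat.succ_injective.injOn
  mono := by
    intro i j h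
    simp only [Finsupp.comapDomain_apply]
    exact P.mono (Nat.succ_le_succ h)

lemma tail_p (P : Ptn) (i : ℕ) : P.tail.p i = P.p (i + 1) := rfl

/-- Add a first part. -/
def cons (s : ℕ) (P : Ptn) (h : P.p 0 ≤ s) : Ptn where
  p := Finsupp.onFinset (insert 0 (P.p.support.image Nat.succ))
    (fun i => Nat.casesOn i s fun j => P.p j) (by
      intro i hi
      cases i with
      | zero => simp
      | succ j => simp at hi ⊢; exact hi)
  mono := by
    intro i j hij
    simp only [Finsupp.onFinset_apply]
    cases j with
    | zero => obtain rfl : i = 0 := by omega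
              exact le_rfl
    | succ j =>
      cases i with
      | zero => exact (P.mono (Nat.zero_le j)).trans h
      | succ i => exact P.mono (by omega)

/-- head and tail -/
def split (P : Ptn) : ℕ × Ptn := (P.p 0, P.tail)

lemma split_inj : Function.Injective split := by
  intro P Q h
  simp only [split, Prod.mk.injEq] at h
  apply ext'
  intro i
  cases i with
  | zero => exact h.1
  | succ i => rw [← tail_p, ← tail_p, h.2]

lemma split_cons (s : ℕ) (P : Ptn) (h : P.p 0 ≤ s) : split (cons s P h) = (s, P) := by
  refine Prod.ext rfl ?_
  apply ext'
  intro i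
  rfl

lemma mem_range_split {x : ℕ × Ptn} (h : x.2.p 0 ≤ x.1) : x ∈ Set.range split :=
  ⟨cons x.1 x.2 h, split_cons _ _ _⟩

lemma tsum_split {M : Type*} [AddCommMonoid M] [TopologicalSpace M] (f : ℕ × Ptn → M)
    (hf : ∀ x, ¬ x.2.p 0 ≤ x.1 → f x = 0) : ∑' P : Ptn, f (P.p 0, P.tail) = ∑' x, f x := by
  refine split_inj.tsum_eq (f := f) ?_
  intro x hx
  apply mem_range_split
  by_contra h
  exact hx (hf x h)

lemma sum_eq_range (P : Ptn) (f : ℕ → ℕ → ℕ) (hf : ∀ i, f i 0 = 0) {L : ℕ}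
    (hL : P.p.support ⊆ Finset.range L) : P.p.sum f = ∑ i ∈ Finset.range L, f i (P.p i) :=
  Finsupp.sum_of_support_subset _ hL _ fun i _ => hf i

lemma exists_L (P : Ptn) : ∃ L, P.p.support ⊆ Finset.range (L + 1) ∧
    P.tail.p.support ⊆ Finset.range L := by
  obtain ⟨L, hL⟩ := P.p.support.exists_nat_subset_range
  refine ⟨L, hL.trans (Finset.range_subset_range.mpr (by omega)), ?_⟩
  intro i hi
  have h1 : i + 1 ∈ P.p.support := by
    rw [Finsupp.mem_support_iff] at hi ⊢
    exact hi
  have := Finset.mem_range.mp (hL h1)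
  exact Finset.mem_range.mpr (by omega)

lemma sum_split (P : Ptn) (f : ℕ → ℕ → ℕ) (hf : ∀ i, f i 0 = 0) :
    P.p.sum f = f 0 (P.p 0) + P.tail.p.sum (fun i v => f (i + 1) v) := by
  obtain ⟨L, h1, h2⟩ := P.exists_L
  rw [sum_eq_range P f hf h1, sum_eq_range P.tail _ (fun i => hf (i + 1)) h2,
    Finset.sum_range_succ', add_comm]
  rfl

lemma wt_split (P : Ptn) : P.wt = P.p 0 + P.tail.wt :=
  sum_split P (fun _ v => v) fun _ => rfl

lemma b_range (q : ℂ) (P : Ptn) {L : ℕ} (hL : P.p.support ⊆ Finset.range L) :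
    bConj q P = ∏ i ∈ Finset.range L, qP q q (P.p i - P.p (i + 1)) := by
  unfold bConj
  apply Finset.prod_subset hL
  intro i _ hi
  rw [Finsupp.notMem_support_iff] at hi
  simp [hi, qP_zero]

lemma b_split (q : ℂ) (P : Ptn) :
    bConj q P = qP q q (P.p 0 - P.tail.p 0) * bConj q P.tail := by
  obtain ⟨L, h1, h2⟩ := P.exists_L
  rw [b_range q P h1, b_range q P.tail h2, Finset.prod_range_succ', mul_comm]
  rfl

/-- exponent -/
def ex (ℓ : ℕ) (P : Ptn) : ℕ := P.p.sum fun i v => if i < ℓ then v * (v - 1) else v * v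

lemma ex_zero (P : Ptn) : ex 0 P = P.p 0 * P.p 0 + ex 0 P.tail := by
  unfold ex
  rw [sum_split _ _ (by intro i; simp)]
  simp

lemma ex_succ (ℓ : ℕ) (P : Ptn) : ex (ℓ + 1) P = P.p 0 * (P.p 0 - 1) + ex ℓ P.tail := by
  unfold ex
  rw [sum_split _ _ (by intro i; simp)]
  simp

lemma sum_range_le (P : Ptn) (n : ℕ) : ∑ i ∈ Finset.range n, P.p i ≤ P.wt := by
  obtain ⟨L, h1, -⟩ := P.exists_L
  have : P.wt = ∑ i ∈ Finset.range (max n (L + 1)), P.p i :=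
    sum_eq_range P (fun _ v => v) (fun _ => rfl)
      (h1.trans (Finset.range_subset_range.mpr (le_max_right _ _)))
  rw [this]
  exact Finset.sum_le_sum_of_subset (Finset.range_subset_range.mpr (le_max_left _ _))

lemma mul_le_wt (P : Ptn) (i : ℕ) : (i + 1) * P.p i ≤ P.wt := by
  refine le_trans ?_ (P.sum_range_le (i + 1))
  have : ∑ _j ∈ Finset.range (i + 1), P.p i ≤ ∑ j ∈ Finset.range (i + 1), P.p j :=
    Finset.sum_le_sum fun j hj => P.mono (by have := Finset.mem_range.mp hj; omega)
  simpa using this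

lemma le_wt (P : Ptn) (i : ℕ) : P.p i ≤ P.wt :=
  le_trans (Nat.le_mul_of_pos_left _ (Nat.succ_pos i)) (P.mul_le_wt i)

lemma eq_zero_of_wt_le (P : Ptn) {i : ℕ} (h : P.wt ≤ i) : P.p i = 0 := by
  by_contra h0
  have h1 := P.mul_le_wt i
  have h2 : (i + 1) * 1 ≤ (i + 1) * P.p i := Nat.mul_le_mul_left _ (by omega)
  omega

/-- encoding -/
def enc (N : ℕ) (P : {P : Ptn // P.wt ≤ N}) : Fin N → Fin (N + 1) :=
  fun i => ⟨P.1.p i, Nat.lt_succ_of_le ((P.1.le_wt i).trans P.2)⟩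

lemma enc_inj (N : ℕ) : Function.Injective (enc N) := by
  rintro ⟨P, hP⟩ ⟨Q, hQ⟩ h
  rw [Subtype.mk.injEq]
  apply ext'
  intro i
  by_cases hi : i < N
  · have := congrFun h ⟨i, hi⟩
    simpa [enc] using this
  · rw [P.eq_zero_of_wt_le (by omega), Q.eq_zero_of_wt_le (by omega)]

instance fin_sub (N : ℕ) : Finite {P : Ptn // P.wt ≤ N} := Finite.of_injective _ (enc_inj N)

lemma fin_wt (N : ℕ) : {P : Ptn | P.wt ≤ N}.Finite := fin_sub N

lemma card_wt (N : ℕ) : Nat.card {P : Ptn // P.wt ≤ N} ≤ (N + 1) ^ N := by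
  have := Nat.card_le_card_of_injective _ (enc_inj N)
  simpa using this

lemma b_ne {q : ℂ} (hq : ‖q‖ < 1) (P : Ptn) : bConj q P ≠ 0 := by
  unfold bConj
  rw [Finset.prod_ne_zero_iff]
  intro i _
  exact qq_ne hq _

end Ptn

open Ptn

lemma fin_wt2 (N : ℕ) : {x : ℕ × Ptn | x.1 + x.2.wt ≤ N}.Finite := by
  refine ((Set.finite_Iic N).prod (fin_wt N)).subset ?_
  rintro ⟨a, P⟩ h
  simp only [Set.mem_ofPred_eq] at h
  simp only [Set.mem_prod, Set.mem_Iic, Set.mem_ofPred_eq]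
  omega

/-- term -/
def hterm (q : ℂ) (ℓ r : ℕ) (P : Ptn) : ℂ⟦X⟧ :=
  if P.p 0 ≤ r then C (q ^ (ex ℓ P) * ((qP q q (r - P.p 0))⁻¹ * (bConj q P)⁻¹)) * X ^ (2 * P.wt)
  else 0

lemma hterm_dvd (q : ℂ) (ℓ r : ℕ) (P : Ptn) : X ^ P.wt ∣ hterm q ℓ r P := by
  unfold hterm
  split_ifs
  · exact (pow_dvd_pow X (by omega)).mul_left _
  · simp

lemma hterm_summable (q : ℂ) (ℓ r : ℕ) : Summable (hterm q ℓ r) :=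
  ps_summable _ Ptn.wt fin_wt (hterm_dvd q ℓ r)

/-- sum -/
def Hh (q : ℂ) (ℓ r : ℕ) : ℂ⟦X⟧ := ∑' P, hterm q ℓ r P

lemma Hh_rec (q : ℂ) (ℓ' ℓ : ℕ) (w : ℕ → ℕ)
    (hw : ∀ P, ex ℓ' P = w (P.p 0) + ex ℓ P.tail) (r : ℕ) :
    Hh q ℓ' r = ∑ s ∈ Finset.range (r + 1),
      C (q ^ (w s) * (qP q q (r - s))⁻¹) * (X ^ 2) ^ s * Hh q ℓ s := by
  set G : ℕ × Ptn → ℂ⟦X⟧ := fun x =>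
    if x.1 ≤ r then C (q ^ (w x.1) * (qP q q (r - x.1))⁻¹) * (X ^ 2) ^ x.1 * hterm q ℓ x.1 x.2
    else 0 with hG
  have h1 : ∀ P, hterm q ℓ' r P = G (P.p 0, P.tail) := by
    intro P
    have ht : P.tail.p 0 ≤ P.p 0 := P.mono (Nat.zero_le 1)
    simp only [hG, hterm, if_pos ht]
    split_ifs
    · rw [hw, b_split, wt_split, mul_add, pow_add, pow_add, mul_inv, ← pow_mul]
      simp only [map_mul]
      ring
    · rfl
  have hGs : Summable G := by
    refine ps_summable _ (fun x => x.1 + x.2.wt) fin_wt2 ?_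
    intro x
    rw [hG]
    simp only
    split_ifs
    · rw [pow_add]
      exact mul_dvd_mul ((pow_dvd_pow_of_dvd (dvd_pow_self X two_ne_zero) _).mul_left _)
        (hterm_dvd _ _ _ _)
    · simp
  have hGs1 : ∀ s, Summable fun P => G (s, P) := by
    intro s
    simp only [hG]
    split_ifs
    · exact (hterm_summable q ℓ s).mul_left _
    · exact summable_zero
  unfold Hh
  simp_rw [h1]
  rw [tsum_split G, hGs.tsum_prod' hGs1, tsum_eq_sum (s := Finset.range (r + 1))]
  · apply Finset.sum_congr rfl
    intro s hs
    have hs : s ≤ r := by simpa [Nat.lt_succ_iff] using hs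
    simp only [hG, if_pos hs]
    rw [(hterm_summable q ℓ s).tsum_mul_left]
  · intro s hs
    have hs : ¬ s ≤ r := by simpa [Nat.lt_succ_iff] using hs
    simp [hG, if_neg hs]
  · intro x hx
    simp [hG, hterm, hx]

lemma X_dvd_sq : (X : ℂ⟦X⟧) ∣ X ^ 2 := dvd_pow_self X two_ne_zero

lemma gP_facts (q : ℂ) (r : ℕ) :
    (gP q (X ^ 2) r)⁻¹ = (1 - X ^ 2 * C (q ^ r)) * (gP q (X ^ 2) (r + 1))⁻¹ ∧
    (gP q (X ^ 2 * C q) r)⁻¹ = (1 - X ^ 2) * (gP q (X ^ 2) (r + 1))⁻¹ := by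
  have a := gP_inv q X_dvd_sq r
  have b := gP_inv q X_dvd_sq (r + 1)
  have c := gP_inv q (X_dvd_sq.mul_right (C q)) r
  constructor
  · apply mul_left_cancel₀ (gP_ne q X_dvd_sq r)
    rw [a, ← mul_assoc, ← gP_succ, b]
  · apply mul_left_cancel₀ (gP_ne q (X_dvd_sq.mul_right (C q)) r)
    rw [c, ← mul_assoc, mul_comm (gP _ _ _), ← gP_succ', b]

lemma Hh_zero {q : ℂ} (hq : ‖q‖ < 1) (r : ℕ) :
    Hh q 0 r = C (qP q q r)⁻¹ * (gP q (X ^ 2 * C q) r)⁻¹ := by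
  have hK : ∀ r, C (qP q q r)⁻¹ * (gP q (X ^ 2 * C q) r)⁻¹ = ∑ s ∈ Finset.range (r + 1),
      C (q ^ (s * s) * (qP q q (r - s))⁻¹) * (X ^ 2) ^ s *
        (C (qP q q s)⁻¹ * (gP q (X ^ 2 * C q) s)⁻¹) := by
    intro r
    rw [← qvand hq (X_dvd_sq.mul_right (C q)) r]
    apply Finset.sum_congr rfl
    intro s _
    have : q ^ (s * s) = q ^ (s * (s - 1)) * q ^ s := by
      rw [← pow_add]; congr 1
      rcases s with _ | s
      · rfl
      · simp; ring
    rw [this, mul_pow]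
    simp only [map_mul, map_pow]
    ring
  induction r using Nat.strong_induction_on with
  | _ r ih =>
    rcases Nat.eq_zero_or_pos r with rfl | hr
    · simp only [qP_zero, gP_zero]
      unfold Hh
      rw [tsum_eq_single (⟨0, by simp⟩ : Ptn)]
      · simp [hterm, ex, bConj, wt, qP_zero]
      · intro P hP
        unfold hterm
        rw [if_neg]
        intro h
        apply hP
        apply ext'
        intro i
        have := P.mono (Nat.zero_le i)
        simp; omega
    · have h1 := Hh_rec q 0 0 (fun s => s * s) ex_zero r
      have h2 := hK r
      rw [Finset.sum_range_succ] at h1 h2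
      have h3 : ∑ s ∈ Finset.range r, C (q ^ (s * s) * (qP q q (r - s))⁻¹) * (X ^ 2) ^ s * Hh q 0 s
        = ∑ s ∈ Finset.range r, C (q ^ (s * s) * (qP q q (r - s))⁻¹) * (X ^ 2) ^ s *
        (C (qP q q s)⁻¹ * (gP q (X ^ 2 * C q) s)⁻¹) := by
        apply Finset.sum_congr rfl
        intro s hs
        rw [ih s (Finset.mem_range.mp hs)]
      rw [h3] at h1
      simp only [Nat.sub_self, qP_zero, inv_one, mul_one] at h1 h2
      have hne : (1 : ℂ⟦X⟧) - C (q ^ (r * r)) * (X ^ 2) ^ r ≠ 0 := by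
        intro h
        have := congrArg constantCoeff h
        simp [hr.ne'] at this
      apply mul_left_cancel₀ hne
      linear_combination h1 - h2

lemma GG_eq {q : ℂ} (ℓ r : ℕ) : GG q ℓ r = C (qP q q r)⁻¹ * (gP q (X ^ 2) (r + 1))⁻¹ *
    ((1 - X ^ 2 * C (q ^ r)) - X ^ (2 * ℓ) * (1 - C (q ^ r))) := by
  rw [GG, (gP_facts q r).1]
  simp only [map_mul, map_sub, map_one]
  ring

lemma GG_one {q : ℂ} (hq : ‖q‖ < 1) (r : ℕ) : Hh q 0 r = GG q 1 r := by
  rw [Hh_zero hq, GG_eq, (gP_facts q r).2]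
  ring

lemma GG_zero {q : ℂ} (hq : ‖q‖ < 1) (r : ℕ) : C (q ^ r) * Hh q 0 r = GG q 0 r := by
  rw [Hh_zero hq, GG_eq, (gP_facts q r).2]
  ring

lemma GG_step {q : ℂ} (hq : ‖q‖ < 1) (ℓ r : ℕ) :
    ∑ s ∈ Finset.range (r + 1),
      C (q ^ (s * (s - 1)) * (qP q q (r - s))⁻¹) * (X ^ 2) ^ s * GG q ℓ s = GG q (ℓ + 1) r := by
  have hA := qvand hq X_dvd_sq r
  have hB : ∑ s ∈ Finset.range (r + 1),
      C (q ^ (s * (s - 1)) * (qP q q (r - s))⁻¹) * (X ^ 2) ^ s *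
        (C ((1 - q ^ s) * (qP q q s)⁻¹) * (gP q (X ^ 2) (s + 1))⁻¹)
      = X ^ 2 * (C ((1 - q ^ r) * (qP q q r)⁻¹) * (gP q (X ^ 2) (r + 1))⁻¹) := by
    rcases r with _ | r
    · simp
    have e2 : ∀ r, (1 - q ^ (r + 1)) * (qP q q (r + 1))⁻¹ = (qP q q r)⁻¹ := by
      intro r
      have a := one_sub_pow_ne hq r
      have b := qq_ne hq r
      rw [qP_succ, ← pow_succ']; field_simp
    have e3 : ∀ r, (gP q (X ^ 2) (r + 1 + 1))⁻¹ = (gP q (X ^ 2) 2)⁻¹ * (gP q (X ^ 2 * C (q ^ 2)) r)⁻¹ := by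
      intro r
      rw [add_assoc, add_comm r, gP_add, PowerSeries.mul_inv_rev, mul_comm]
    rw [Finset.sum_range_succ', e2, e3]
    have h := qvand hq (X_dvd_sq.mul_right (C (q ^ 2))) r
    have h' : X ^ 2 * (C (qP q q r)⁻¹ * ((gP q (X ^ 2) 2)⁻¹ * (gP q (X ^ 2 * C (q ^ 2)) r)⁻¹)) =
      X ^ 2 * (gP q (X ^ 2) 2)⁻¹ * (C (qP q q r)⁻¹ * (gP q (X ^ 2 * C (q ^ 2)) r)⁻¹) := by ring
    rw [h', ← h, Finset.mul_sum]
    simp only [pow_zero, sub_self, zero_mul, map_zero, mul_zero, add_zero]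
    apply Finset.sum_congr rfl
    intro s _
    rw [e2, e3]
    have e4 : r + 1 - (s + 1) = r - s := by omega
    have e5 : (s + 1) * (s + 1 - 1) = s * (s - 1) + 2 * s := by
      rcases s with _ | s
      · simp
      · simp; ring
    rw [e4, e5, mul_pow, pow_add q, pow_mul q]
    simp only [map_mul, map_pow]
    ring
  have hG : ∀ ℓ s, GG q ℓ s = C (qP q q s)⁻¹ * (gP q (X ^ 2) s)⁻¹ -
    X ^ (2 * ℓ) * (C ((1 - q ^ s) * (qP q q s)⁻¹) * (gP q (X ^ 2) (s + 1))⁻¹) := by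
    intro ℓ s; rw [GG]; ring
  simp_rw [hG, mul_sub, Finset.sum_sub_distrib, hA]
  congr 1
  have e : X ^ (2 * (ℓ + 1)) * (C ((1 - q ^ r) * (qP q q r)⁻¹) * (gP q (X ^ 2) (r + 1))⁻¹) =
    X ^ (2 * ℓ) * (X ^ 2 * (C ((1 - q ^ r) * (qP q q r)⁻¹) * (gP q (X ^ 2) (r + 1))⁻¹)) := by ring
  rw [e, ← hB, Finset.mul_sum]
  apply Finset.sum_congr rfl
  intro s _
  ring

lemma Hh_eq {q : ℂ} (hq : ‖q‖ < 1) (ℓ : ℕ) : ∀ r, Hh q ℓ r = GG q (ℓ + 1) r := by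
  induction ℓ with
  | zero => exact GG_one hq
  | succ ℓ ih =>
    intro r
    rw [Hh_rec q (ℓ + 1) ℓ (fun s => s * (s - 1)) (ex_succ ℓ) r, ← GG_step hq]
    simp_rw [ih]

/-- exponent -/
def cexp (ℓ r : ℕ) (P : Ptn) : ℕ := r.choose 2 + (if ℓ = 0 then r else 0) + ex (ℓ - 1) P

/-- coefficient -/
def cco (q : ℂ) (ℓ : ℕ) (x : Ptn × ℕ) : ℂ :=
  (-1) ^ x.2 * q ^ (x.2 * x.1.p 0 + cexp ℓ (x.1.p 0) x.1.tail) *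
    ((qP q q x.2)⁻¹ * (bConj q x.1)⁻¹)

/-- degree -/
def cdeg (x : Ptn × ℕ) : ℕ := x.2 + (x.1.p 0 + 2 * x.1.tail.wt)

lemma fin_cdeg (N : ℕ) : {x | cdeg x ≤ N}.Finite := by
  refine ((fin_wt N).prod (Set.finite_Iic N)).subset ?_
  rintro ⟨P, k⟩ h
  simp only [cdeg, Set.mem_ofPred_eq] at h
  have := P.wt_split
  simp only [Set.mem_prod, Set.mem_Iic, Set.mem_ofPred_eq]
  omega

lemma formal_main {q : ℂ} (hq : ‖q‖ < 1) (ℓ : ℕ) :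
    ∑' x : Ptn × ℕ, C (cco q ℓ x) * X ^ (cdeg x) = (1 - X ^ (2 * ℓ + 1)) * EE q (X ^ 2) := by
  have hnX : (X : ℂ⟦X⟧) ∣ -X := dvd_neg.mpr dvd_rfl
  set G : ℕ × Ptn → ℂ⟦X⟧ := fun x =>
    C (q ^ (x.1.choose 2)) * X ^ x.1 * EE q (-X * C (q ^ x.1)) *
      (C (q ^ (if ℓ = 0 then x.1 else 0)) * hterm q (ℓ - 1) x.1 x.2) with hG
  have hs : Summable fun x : Ptn × ℕ => C (cco q ℓ x) * X ^ (cdeg x) :=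
    ps_summable _ cdeg fin_cdeg fun x => (dvd_refl _).mul_left _
  have hs1 : ∀ P : Ptn, Summable fun k : ℕ => C (cco q ℓ (P, k)) * X ^ (cdeg (P, k)) := by
    intro P
    refine ps_summable _ id fin_le1 ?_
    intro k
    exact (pow_dvd_pow X (by simp [cdeg])).mul_left _
  rw [hs.tsum_prod' hs1]
  have h1 : ∀ P : Ptn, ∑' k : ℕ, C (cco q ℓ (P, k)) * X ^ (cdeg (P, k)) = G (P.p 0, P.tail) := by
    intro P
    have ht : P.tail.p 0 ≤ P.p 0 := P.mono (Nat.zero_le 1)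
    have hE := sum_pow (hnX.mul_right (C (q ^ (P.p 0)))) (fun k => (qP q q k)⁻¹)
    simp only [hG, hterm, if_pos ht]
    rw [EE, ← hE.tsum_mul_left, ← (hE.mul_left _).tsum_mul_right]
    congr 1; ext1 k
    simp only [cco, cdeg, cexp]
    rw [b_split, mul_inv, mul_comm k, pow_add q, pow_mul, pow_add q, pow_add q, pow_add X, pow_add X,
      mul_pow, neg_pow X]
    simp only [map_mul, map_pow, map_neg, map_one]
    ring
  simp_rw [h1]
  have hGs : Summable G := by
    refine ps_summable _ (fun x => x.1 + x.2.wt) fin_wt2 ?_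
    intro x
    simp only [hG]
    rw [pow_add]
    exact mul_dvd_mul (((dvd_refl (X ^ x.1)).mul_left _).mul_right _)
      ((hterm_dvd q (ℓ - 1) x.1 x.2).mul_left _)
  have hGs1 : ∀ s, Summable fun P => G (s, P) := by
    intro s
    have h0 := (hterm_summable q (ℓ - 1) s).mul_left (C (q ^ (if ℓ = 0 then s else 0)))
    exact h0.mul_left (C (q ^ (s.choose 2)) * X ^ s * EE q (-X * C (q ^ s)))
  rw [tsum_split G, hGs.tsum_prod' hGs1, ← phi_GG hq]
  · congr 1; ext1 r
    simp only [hG]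
    rw [((hterm_summable q (ℓ - 1) r).mul_left _).tsum_mul_left,
      (hterm_summable q (ℓ - 1) r).tsum_mul_left]
    congr 1
    change _ * Hh q (ℓ - 1) r = _
    rcases ℓ with _ | ℓ
    · simp only [if_true]; exact GG_zero hq r
    · simp [Hh_eq hq]
  · intro x hx
    simp [hG, hterm, hx]

end

noncomputable section
open PowerSeries PowerSeries.WithPiTopology
open Ptn Filter Topology

/-- the weight -/
def ww (q a : ℂ) (N : ℕ) : ℂ := a ^ N * q ^ ((N + 1).choose 2)

lemma transfer {ι : Type*} (c : ι → ℂ) (d : ι → ℕ) (hd : ∀ N, {i | d i ≤ N}.Finite) (w : ℕ → ℂ)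
    (hs : Summable fun i => c i * w (d i)) :
    HasSum (fun N => w N * coeff N (∑' i, C (c i) * X ^ (d i) : ℂ⟦X⟧)) (∑' i, c i * w (d i)) := by
  have h1 := (Equiv.hasSum_iff (Equiv.sigmaFiberEquiv d)).mpr hs.hasSum
  refine h1.sigma ?_
  intro N
  have hS : Summable fun i => (C (c i) * X ^ (d i) : ℂ⟦X⟧) :=
    ps_summable _ d hd fun x => (dvd_refl _).mul_left _
  have h2 := (hasSum_iff_hasSum_coeff ℂ).mp hS.hasSum N
  have h3 := h2.mul_left (w N)
  have h4 : (fun i => w N * coeff N (C (c i) * X ^ (d i) : ℂ⟦X⟧))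
      = Set.indicator {i | d i = N} (fun i => c i * w (d i)) := by
    ext i
    rw [coeff_C_mul, coeff_X_pow, Set.indicator_apply]
    simp only [Set.mem_ofPred_eq]
    by_cases h : d i = N
    · simp [h, mul_comm]
    · simp [h, Ne.symm h]
  rw [h4, ← hasSum_subtype_iff_indicator] at h3
  exact h3

lemma summable_base {D Q : ℝ} (hD : 1 ≤ D) (hQ0 : 0 ≤ Q) (hQ : Q < 1) :
    Summable fun N : ℕ => ((N : ℝ) + 1) ^ (N + 1) * (D ^ N * Q ^ ((N + 1).choose 2)) := by
  set s := Real.sqrt Q with hs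
  have hs0 : 0 ≤ s := Real.sqrt_nonneg _
  have hs1 : s < 1 := by rw [hs, Real.sqrt_lt' one_pos]; simpa using hQ
  have hsQ : Q = s ^ 2 := (Real.sq_sqrt hQ0).symm
  have ht : Tendsto (fun N : ℕ => ((N : ℝ) + 1) * s ^ N * D) atTop (𝓝 0) := by
    have a1 := tendsto_self_mul_const_pow_of_lt_one hs0 hs1
    have a2 := tendsto_pow_atTop_nhds_zero_of_lt_one hs0 hs1
    have := (a1.add a2).mul_const D
    simp only [add_zero, zero_mul] at this
    refine this.congr fun N => by ring
  have hev : ∀ᶠ N : ℕ in atTop, ((N : ℝ) + 1) * s ^ N * D < 1 / 2 :=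
    ht.eventually (gt_mem_nhds (by norm_num))
  refine Summable.of_norm_bounded_eventually_nat (g := fun N : ℕ => (1 / 2 : ℝ) ^ N)
    (summable_geometric_of_lt_one (by norm_num) (by norm_num)) ?_
  filter_upwards [hev] with N hN
  have hD0 : 0 ≤ D := by linarith
  rw [Real.norm_of_nonneg (by positivity)]
  have e1 : Q ^ ((N + 1).choose 2) = (s ^ N) ^ (N + 1) := by
    rw [hsQ, ← pow_mul, ← pow_mul]
    congr 1
    have := Nat.triangle_succ N
    rw [Nat.choose_two_right]
    have h2 : 2 ∣ (N + 1) * N := (Nat.even_mul_succ_self N).two_dvd.trans (by rw [mul_comm])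
    have := Nat.mul_div_cancel' h2
    simp only [Nat.add_sub_cancel]
    rw [this]; ring
  calc ((N : ℝ) + 1) ^ (N + 1) * (D ^ N * Q ^ ((N + 1).choose 2))
      ≤ ((N : ℝ) + 1) ^ (N + 1) * (D ^ (N + 1) * Q ^ ((N + 1).choose 2)) := by
        gcongr
        omega
    _ = (((N : ℝ) + 1) * s ^ N * D) ^ (N + 1) := by rw [e1, mul_pow, mul_pow]; ring
    _ ≤ (1 / 2) ^ (N + 1) := by gcongr
    _ ≤ (1 / 2) ^ N := pow_le_pow_of_le_one (by norm_num) (by norm_num) (by omega)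

lemma summable_base1 {D Q : ℝ} (hD : 1 ≤ D) (hQ0 : 0 ≤ Q) (hQ : Q < 1) :
    Summable fun N : ℕ => D ^ N * Q ^ ((N + 1).choose 2) := by
  have hD0 : 0 ≤ D := by linarith
  refine Summable.of_nonneg_of_le (fun N => by positivity) (fun N => ?_) (summable_base hD hQ0 hQ)
  refine le_mul_of_one_le_left (by positivity) ?_
  apply one_le_pow₀
  have : (0 : ℝ) ≤ N := Nat.cast_nonneg N
  linarith

lemma summable_fiber {ι : Type*} (d : ι → ℕ) (g : ℕ → ℝ) (hg : ∀ N, 0 ≤ g N)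
    (hfin : ∀ N, {i | d i ≤ N}.Finite)
    (hcard : ∀ N, Nat.card {i // d i ≤ N} ≤ (N + 1) ^ (N + 1))
    (hs : Summable fun N : ℕ => ((N : ℝ) + 1) ^ (N + 1) * g N) :
    Summable fun i => g (d i) := by
  rw [← (Equiv.sigmaFiberEquiv d).summable_iff]
  rw [summable_sigma_of_nonneg (by intro x; exact hg _)]
  have hF : ∀ N, Finite {i // d i = N} := fun N =>
    ((hfin N).subset (fun i (hi : d i = N) => (le_of_eq hi : d i ≤ N))).to_subtype
  constructor
  · intro N
    have := hF N
    exact Summable.of_finite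
  · refine Summable.of_nonneg_of_le (fun N => tsum_nonneg fun x => hg _) (fun N => ?_) hs
    have := hF N
    have h2 : Finite {i // d i ≤ N} := (hfin N).to_subtype
    have h1 : ∀ x : {i // d i = N}, ((fun i => g (d i)) ∘ (Equiv.sigmaFiberEquiv d)) ⟨N, x⟩ = g N := by
      rintro ⟨i, hi⟩
      simp [Equiv.sigmaFiberEquiv, hi]
    simp_rw [h1]
    rw [tsum_const, nsmul_eq_mul]
    refine mul_le_mul_of_nonneg_right ?_ (hg N)
    have h3 : Nat.card {i // d i = N} ≤ Nat.card {i // d i ≤ N} :=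
      Nat.card_le_card_of_injective (fun x => ⟨x.1, x.2.le⟩) (by
        rintro ⟨x, hx⟩ ⟨y, hy⟩ h
        simpa using h)
    exact_mod_cast h3.trans (hcard N)

lemma card_cdeg (N : ℕ) : Nat.card {x // cdeg x ≤ N} ≤ (N + 1) ^ (N + 1) := by
  have hf : Finite {P : Ptn // P.wt ≤ N} := (fin_wt N).to_subtype
  have hw : ∀ x : {x // cdeg x ≤ N}, x.1.1.wt ≤ N ∧ x.1.2 < N + 1 := by
    rintro ⟨⟨P, k⟩, h⟩
    simp only [cdeg] at h
    have := P.wt_split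
    simp only
    omega
  have := Nat.card_le_card_of_injective
    (fun x : {x // cdeg x ≤ N} => ((⟨x.1.1, (hw x).1⟩, ⟨x.1.2, (hw x).2⟩) :
      {P : Ptn // P.wt ≤ N} × Fin (N + 1))) (by
      rintro ⟨⟨P, k⟩, h⟩ ⟨⟨P', k'⟩, h'⟩ hh
      simpa using hh)
  refine this.trans ?_
  rw [Nat.card_prod, Nat.card_fin, pow_succ]
  exact Nat.mul_le_mul_right _ (card_wt N)

lemma qq_inv_le {q : ℂ} (hq : ‖q‖ < 1) (n : ℕ) : ‖(qP q q n)⁻¹‖ ≤ ((1 - ‖q‖)⁻¹) ^ n := by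
  have h0 : 0 < 1 - ‖q‖ := by linarith
  rw [norm_inv, inv_pow]
  apply inv_anti₀ (by positivity)
  induction n with
  | zero => simp [qP_zero]
  | succ n ih =>
    rw [qP_succ, norm_mul, pow_succ]
    refine mul_le_mul ih ?_ h0.le (norm_nonneg _)
    have h1 : ‖q * q ^ n‖ ≤ ‖q‖ := by
      rw [norm_mul, norm_pow]
      exact mul_le_of_le_one_right (norm_nonneg _) (pow_le_one₀ (norm_nonneg _) hq.le)
    have := norm_sub_norm_le (1 : ℂ) (q * q ^ n)
    rw [norm_one] at this
    linarith

lemma b_inv_le {q : ℂ} (hq : ‖q‖ < 1) (P : Ptn) :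
    ‖(bConj q P)⁻¹‖ ≤ ((1 - ‖q‖)⁻¹) ^ (P.p 0) := by
  obtain ⟨L, h1, -⟩ := P.exists_L
  rw [b_range q P h1]
  have hB : 1 ≤ (1 - ‖q‖)⁻¹ := (one_le_inv₀ (by linarith)).mpr (by linarith [norm_nonneg q])
  have key : ∀ L, ‖(∏ i ∈ Finset.range L, qP q q (P.p i - P.p (i + 1)))⁻¹‖
      ≤ ((1 - ‖q‖)⁻¹) ^ (P.p 0 - P.p L) := by
    intro L
    induction L with
    | zero => simp
    | succ L ih =>
      rw [Finset.prod_range_succ, mul_inv, norm_mul]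
      have e : P.p 0 - P.p (L + 1) = (P.p 0 - P.p L) + (P.p L - P.p (L + 1)) := by
        have := P.mono (Nat.zero_le L)
        have := P.mono (Nat.le_succ L)
        simp only [Nat.succ_eq_add_one] at this
        omega
      rw [e, pow_add]
      exact mul_le_mul ih (qq_inv_le hq _) (norm_nonneg _) (by positivity)
  exact (key _).trans (pow_le_pow_right₀ hB (Nat.sub_le _ _))

/-- The constant. -/
def DD (q a : ℂ) : ℝ := (1 + ‖a‖) * (1 - ‖q‖)⁻¹

lemma DD_ge {q : ℂ} (hq : ‖q‖ < 1) (a : ℂ) : 1 ≤ DD q a := by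
  have hB : 1 ≤ (1 - ‖q‖)⁻¹ := (one_le_inv₀ (by linarith)).mpr (by linarith [norm_nonneg q])
  exact one_le_mul_of_one_le_of_one_le (by linarith [norm_nonneg a]) hB

lemma term_bound {q : ℂ} (hq : ‖q‖ < 1) (a c : ℂ) (N j : ℕ) (hj : j ≤ N)
    (hc : ‖c‖ ≤ ((1 - ‖q‖)⁻¹) ^ j) :
    ‖c * ww q a N‖ ≤ DD q a ^ N * ‖q‖ ^ ((N + 1).choose 2) := by
  have hB : 1 ≤ (1 - ‖q‖)⁻¹ := (one_le_inv₀ (by linarith)).mpr (by linarith [norm_nonneg q])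
  rw [ww, norm_mul, norm_mul, norm_pow, norm_pow, DD, ← mul_assoc]
  refine mul_le_mul_of_nonneg_right ?_ (by positivity)
  rw [mul_pow, mul_comm]
  refine mul_le_mul ?_ (hc.trans (pow_le_pow_right₀ hB hj)) (norm_nonneg _) (by positivity)
  exact pow_le_pow_left₀ (norm_nonneg _) (by linarith) _

lemma summable_main {q : ℂ} (hq : ‖q‖ < 1) (a : ℂ) (ℓ : ℕ) :
    Summable fun x : Ptn × ℕ => cco q ℓ x * ww q a (cdeg x) := by
  have hD := DD_ge hq a
  have h := summable_fiber cdeg (fun N => DD q a ^ N * ‖q‖ ^ ((N + 1).choose 2))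
    (fun N => by have : 0 ≤ DD q a := by linarith
                 positivity) fin_cdeg card_cdeg (summable_base hD (norm_nonneg q) hq)
  refine Summable.of_norm_bounded h ?_
  rintro ⟨P, k⟩
  refine term_bound hq a _ _ (k + P.p 0) (by simp only [cdeg]; omega) ?_
  simp only [cco]
  rw [norm_mul, norm_mul, norm_mul, norm_pow, norm_pow, norm_neg, norm_one, one_pow, one_mul,
    pow_add _ k]
  refine le_trans (mul_le_of_le_one_left ?_ (pow_le_one₀ (norm_nonneg q) hq.le)) ?_
  · positivity
  exact mul_le_mul (qq_inv_le hq _) (b_inv_le hq _) (norm_nonneg _)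
    (by have : 0 < 1 - ‖q‖ := by linarith
        positivity)

lemma summable_single {q : ℂ} (hq : ‖q‖ < 1) (a : ℂ) (d : ℕ → ℕ) (hd : Function.Injective d)
    (hd' : ∀ i, i ≤ d i) :
    Summable fun i : ℕ => (qP q q i)⁻¹ * ww q a (d i) := by
  have hD := DD_ge hq a
  have h := (summable_base1 hD (norm_nonneg q) hq).comp_injective hd
  refine Summable.of_norm_bounded h fun i => ?_
  exact term_bound hq a _ _ i (hd' i) (qq_inv_le hq i)

lemma sum_formal {q : ℂ} (hq : ‖q‖ < 1) (a : ℂ) (ℓ : ℕ) :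
    ∑' x : Ptn × ℕ, cco q ℓ x * ww q a (cdeg x) =
      ∑' i : ℕ, (ww q a (2 * i) - ww q a (2 * i + 2 * ℓ + 1)) * (qP q q i)⁻¹ := by
  have h1 := transfer (cco q ℓ) cdeg fin_cdeg (ww q a) (summable_main hq a ℓ)
  have s2 := summable_single hq a (fun i => 2 * i) (fun i j h => by simpa using h)
    (fun i => by omega)
  have s3 := summable_single hq a (fun i => 2 * i + 2 * ℓ + 1)
    (fun i j h => by simpa using h) (fun i => by omega)
  have f2 : ∀ N, {i : ℕ | 2 * i ≤ N}.Finite := fun N =>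
    (Set.finite_Iic N).subset fun i hi => by
      simp only [Set.mem_ofPred_eq, Set.mem_Iic] at *; omega
  have f3 : ∀ N, {i : ℕ | 2 * i + 2 * ℓ + 1 ≤ N}.Finite := fun N =>
    (Set.finite_Iic N).subset fun i hi => by
      simp only [Set.mem_ofPred_eq, Set.mem_Iic] at *; omega
  have h2 := transfer (fun i : ℕ => (qP q q i)⁻¹) _ f2 (ww q a) s2
  have h3 := transfer (fun i : ℕ => (qP q q i)⁻¹) _ f3 (ww q a) s3
  rw [formal_main hq ℓ] at h1
  have e2 : ∑' i : ℕ, (C (qP q q i)⁻¹ * X ^ (2 * i) : ℂ⟦X⟧) = EE q (X ^ 2) := by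
    simp only [EE, pow_mul]
  have e3 : ∑' i : ℕ, (C (qP q q i)⁻¹ * X ^ (2 * i + 2 * ℓ + 1) : ℂ⟦X⟧)
      = X ^ (2 * ℓ + 1) * EE q (X ^ 2) := by
    rw [EE, ← (sum_pow X_dvd_sq _).tsum_mul_left]
    congr 1; ext1 i
    ring
  rw [e2] at h2
  rw [e3] at h3
  have h4 := h2.sub h3
  have h5 : (fun N => ww q a N * (coeff N) ((1 - X ^ (2 * ℓ + 1)) * EE q (X ^ 2))) =
      fun N => ww q a N * coeff N (EE q (X ^ 2)) -
        ww q a N * coeff N (X ^ (2 * ℓ + 1) * EE q (X ^ 2)) := by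
    ext N
    rw [sub_mul, one_mul, map_sub, mul_sub]
  rw [h5] at h1
  rw [h1.unique h4, ← s2.tsum_sub s3]
  congr 1; ext1 i
  ring

end

noncomputable section
open Ptn Filter Topology

/-- Euler coefficient -/
def ec (q : ℂ) (k : ℕ) : ℂ := (-1) ^ k * q ^ (k.choose 2) * (qP q q k)⁻¹

/-- Euler series -/
def eF (q y : ℂ) : ℂ := ∑' k : ℕ, ec q k * y ^ k

lemma ec_bound {q : ℂ} (hq : ‖q‖ < 1) (y : ℂ) (k : ℕ) :
    ‖ec q k * y ^ k‖ ≤ ((1 - ‖q‖)⁻¹) ^ k * ‖q‖ ^ (k.choose 2) * ‖y‖ ^ k := by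
  rw [ec, norm_mul, norm_mul, norm_mul, norm_pow, norm_pow, norm_pow, norm_neg, norm_one, one_pow,
    one_mul, mul_comm (‖q‖ ^ _)]
  gcongr
  exact qq_inv_le hq k

lemma ec_dom {q : ℂ} (hq : ‖q‖ < 1) (M : ℝ) (hM : 0 ≤ M) :
    Summable fun k : ℕ => ((1 - ‖q‖)⁻¹) ^ k * ‖q‖ ^ (k.choose 2) * M ^ k := by
  rw [← summable_nat_add_iff 1]
  have hB : 1 ≤ (1 - ‖q‖)⁻¹ := (one_le_inv₀ (by linarith)).mpr (by linarith [norm_nonneg q])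
  have hD : 1 ≤ (1 - ‖q‖)⁻¹ * (1 + M) := one_le_mul_of_one_le_of_one_le hB (by linarith)
  have h := (summable_base1 hD (norm_nonneg q) hq).mul_left ((1 - ‖q‖)⁻¹ * (1 + M))
  refine Summable.of_nonneg_of_le (fun k => by positivity) (fun k => ?_) h
  have : M ^ (k + 1) ≤ (1 + M) ^ (k + 1) := pow_le_pow_left₀ hM (by linarith) _
  calc _ ≤ ((1 - ‖q‖)⁻¹) ^ (k + 1) * ‖q‖ ^ ((k + 1).choose 2) * (1 + M) ^ (k + 1) := by gcongr
    _ = _ := by rw [mul_pow]; ring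

lemma ec_summable {q : ℂ} (hq : ‖q‖ < 1) (y : ℂ) : Summable fun k : ℕ => ec q k * y ^ k :=
  Summable.of_norm_bounded (ec_dom hq ‖y‖ (norm_nonneg _)) (ec_bound hq y)

lemma ec_succ {q : ℂ} (hq : ‖q‖ < 1) (k : ℕ) :
    ec q (k + 1) * (1 - q ^ (k + 1)) = - (ec q k * q ^ k) := by
  have h1 := one_sub_pow_ne hq k
  have h2 := qq_ne hq k
  have e : (k + 1).choose 2 = k + k.choose 2 := by
    rw [Nat.choose_succ_succ' k 1, Nat.choose_one_right]
  have e2 : qP q q (k + 1) = qP q q k * (1 - q ^ (k + 1)) := by rw [qP_succ, pow_succ']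
  rw [ec, ec, e2, e, pow_add, pow_succ]
  field_simp
  ring

lemma eF_mul {q : ℂ} (hq : ‖q‖ < 1) (y : ℂ) : eF q y = (1 - y) * eF q (y * q) := by
  have h1 := ec_summable hq y
  have h2 := ec_summable hq (y * q)
  have key : eF q y - eF q (y * q) = - y * eF q (y * q) := by
    rw [eF, eF, ← h1.tsum_sub h2, (h1.sub h2).tsum_eq_zero_add, ← tsum_mul_left]
    simp only [pow_zero, sub_self, zero_add]
    congr 1; ext1 k
    have := ec_succ hq k
    linear_combination y ^ (k + 1) * this
  linear_combination key

lemma eF_mul_pow {q : ℂ} (hq : ‖q‖ < 1) (y : ℂ) (n : ℕ) :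
    eF q y = qP q y n * eF q (y * q ^ n) := by
  induction n with
  | zero => simp [qP_zero]
  | succ n ih =>
    rw [ih, eF_mul hq (y * q ^ n), qP_succ, pow_succ]
    ring_nf

lemma eF_tendsto {q : ℂ} (hq : ‖q‖ < 1) (y : ℂ) :
    Tendsto (fun n : ℕ => eF q (y * q ^ n)) atTop (𝓝 1) := by
  have h0 : (1 : ℂ) = ∑' k : ℕ, ec q k * 0 ^ k := by
    rw [tsum_eq_single 0]
    · simp [ec, qP_zero]
    · intro k hk; simp [hk]
  rw [h0]
  have hy : Tendsto (fun n : ℕ => y * q ^ n) atTop (𝓝 0) := by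
    simpa using (tendsto_pow_atTop_nhds_zero_of_norm_lt_one hq).const_mul y
  refine tendsto_tsum_of_dominated_convergence (ec_dom hq ‖y‖ (norm_nonneg _)) ?_ ?_
  · intro k
    exact (hy.pow k).const_mul _
  · refine Eventually.of_forall fun n k => (ec_bound hq _ k).trans ?_
    have h0 : 0 < 1 - ‖q‖ := by linarith
    have : ‖y * q ^ n‖ ≤ ‖y‖ := by
      rw [norm_mul, norm_pow]
      exact mul_le_of_le_one_right (norm_nonneg _) (pow_le_one₀ (norm_nonneg _) hq.le)
    gcongr

lemma qPInf_eq {q : ℂ} (hq : ‖q‖ < 1) (y : ℂ) : qPInf q y = eF q y := by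
  have hm : Multipliable fun m : ℕ => (1 - y * q ^ m) := by
    have : Summable fun m : ℕ => ‖-(y * q ^ m)‖ := by
      simp only [norm_neg, norm_mul, norm_pow]
      exact (summable_geometric_of_lt_one (norm_nonneg _) hq).mul_left _
    simpa [sub_eq_add_neg] using multipliable_one_add_of_summable this
  have h1 := hm.hasProd.tendsto_prod_nat
  have h2 := h1.mul (eF_tendsto hq y)
  have h3 : (fun n : ℕ => (∏ i ∈ Finset.range n, (1 - y * q ^ i)) * eF q (y * q ^ n))
      = fun _ => eF q y := by
    ext n
    exact (eF_mul_pow hq y n).symm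
  rw [h3, mul_one] at h2
  exact (tendsto_nhds_unique tendsto_const_nhds h2).symm

lemma qPa_ne {q a : ℂ} (ha : ∀ m : ℕ, 1 ≤ m → a * q ^ m ≠ 1) (n : ℕ) : qP q (a * q) n ≠ 0 := by
  unfold qP
  rw [Finset.prod_ne_zero_iff]
  intro i _ h
  apply ha (i + 1) (by omega)
  rw [pow_succ']
  linear_combination -h

lemma qPInf_ne {q a : ℂ} (hq : ‖q‖ < 1) (ha : ∀ m : ℕ, 1 ≤ m → a * q ^ m ≠ 1) :
    qPInf q (a * q) ≠ 0 := by
  rw [qPInf_eq hq]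
  have h := (eF_tendsto hq (a * q)).eventually_ne one_ne_zero
  obtain ⟨n, hn⟩ := h.exists
  rw [eF_mul_pow hq _ n]
  exact mul_ne_zero (qPa_ne ha n) hn

lemma two_choose (n : ℕ) : 2 * n.choose 2 + n = n * n := by
  induction n with
  | zero => rfl
  | succ n ih =>
    rw [Nat.choose_succ_succ' n 1, Nat.choose_one_right]
    linarith

lemma ch2_nat (n : ℕ) : ch2 (n : ℤ) = (n.choose 2 : ℕ) := by
  have h := two_choose n
  unfold ch2
  have : (n : ℤ) * (n - 1) = 2 * (n.choose 2 : ℕ) := by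
    have : (2 : ℤ) * (n.choose 2 : ℕ) + n = n * n := by exact_mod_cast h
    linarith
  rw [this]
  simp

lemma sq_head (ℓ : ℕ) (P : Ptn) : ex ℓ P + P.headSum ℓ = P.p.sum fun _ v => v * v := by
  induction ℓ generalizing P with
  | zero => simp [ex, headSum]
  | succ ℓ ih =>
    rw [ex_succ, sum_split _ _ (by intro i; simp), ← ih P.tail, headSum, Finset.sum_range_succ',
      headSum]
    simp only [tail_p]
    have : P.p 0 * (P.p 0 - 1) + P.p 0 = P.p 0 * P.p 0 := by
      rcases P.p 0 with _ | r
      · rfl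
      · simp; ring
    omega

lemma sq_nConj (P : Ptn) : 2 * P.nConj + P.wt = P.p.sum fun _ v => v * v := by
  have h : P.nConj = ∑ j ∈ P.p.support, (P.p j).choose 2 := by
    unfold nConj conj
    simp only [Finset.card_filter, Finset.mul_sum]
    rw [Finset.sum_comm]
    refine Finset.sum_congr rfl fun j _ => ?_
    have hj : P.p j ≤ P.p 0 := P.mono (Nat.zero_le j)
    simp only [mul_ite, mul_one, mul_zero]
    rw [← Finset.sum_filter, Nat.choose_two_right, ← Finset.sum_range_id]
    refine Finset.sum_congr ?_ fun _ _ => rfl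
    ext i
    simp only [Finset.mem_filter, Finset.mem_range]
    omega
  rw [h, wt, Finsupp.sum, Finsupp.sum, Finset.mul_sum, ← Finset.sum_add_distrib]
  exact Finset.sum_congr rfl fun j _ => two_choose _

/-- natural exponent -/
def en (ℓ : ℕ) (P : Ptn) : ℕ := 2 * P.wt * P.tail.wt + P.wt + ex ℓ P

lemma en_eq (ℓ : ℕ) (P : Ptn) :
    ch2 (2 * (P.wt : ℤ) + 1) - 2 * (P.wt : ℤ) * (P.p 0 : ℤ) + 2 * (P.nConj : ℤ)
            + (P.wt : ℤ) - (P.headSum ℓ : ℤ) = (en ℓ P : ℕ) := by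
  have h1 := sq_head ℓ P
  rw [← sq_nConj] at h1
  have h2 := P.wt_split
  have h3 := two_choose (2 * P.wt + 1)
  have h4 := ch2_nat (2 * P.wt + 1)
  push_cast at h4
  rw [h4, en]
  zify at h1 h2 h3
  push_cast
  have h5 : (P.tail.wt : ℤ) = P.wt - P.p 0 := by linarith
  rw [h5]
  linarith

lemma exp_eq (ℓ : ℕ) (P : Ptn) (k : ℕ) :
    k.choose 2 + (2 * P.wt + 1) * k + en ℓ P =
      (k * P.p 0 + cexp ℓ (P.p 0) P.tail) + (cdeg (P, k) + 1).choose 2 := by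
  have h1 := two_choose k
  have h2 := two_choose (P.p 0)
  have h3 := two_choose (cdeg (P, k) + 1)
  have h5 : ex ℓ P + P.p 0 =
      P.p 0 * P.p 0 + (if ℓ = 0 then P.p 0 else 0) + ex (ℓ - 1) P.tail := by
    rcases ℓ with _ | ℓ
    · rw [ex_zero]; simp; ring
    · rw [ex_succ]
      have : P.p 0 * (P.p 0 - 1) + P.p 0 = P.p 0 * P.p 0 := by
        rcases P.p 0 with _ | r
        · rfl
        · simp; ring
      simp
      omega
  have hw := P.wt_split
  simp only [cdeg] at h3 ⊢
  rw [en, cexp, hw]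
  zify at *
  linarith

lemma lhs_term {q a : ℂ} (hq : ‖q‖ < 1) (ha : ∀ m : ℕ, 1 ≤ m → a * q ^ m ≠ 1) (ℓ : ℕ) (P : Ptn) :
    a ^ (2 * P.wt - P.p 0) *
        q ^ (ch2 (2 * (P.wt : ℤ) + 1) - 2 * (P.wt : ℤ) * (P.p 0 : ℤ) + 2 * (P.nConj : ℤ)
            + (P.wt : ℤ) - (P.headSum ℓ : ℤ)) *
        ((qP q (a * q) (2 * P.wt))⁻¹ * (Ptn.bConj q P)⁻¹) =
    (qPInf q (a * q))⁻¹ * ∑' k : ℕ, cco q ℓ (P, k) * ww q a (cdeg (P, k)) := by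
  have h1 : (qP q (a * q) (2 * P.wt))⁻¹ =
      (qPInf q (a * q))⁻¹ * eF q (a * q * q ^ (2 * P.wt)) := by
    have := qPInf_ne hq ha
    have h2 := qPa_ne ha (2 * P.wt)
    have h3 := eF_mul_pow hq (a * q) (2 * P.wt)
    rw [← qPInf_eq hq] at h3
    field_simp
    rw [h3]
  rw [en_eq, zpow_natCast, h1]
  have h2 : ∀ k, cco q ℓ (P, k) * ww q a (cdeg (P, k)) =
      (a ^ (2 * P.wt - P.p 0) * q ^ (en ℓ P) * (bConj q P)⁻¹) *
        (ec q k * (a * q * q ^ (2 * P.wt)) ^ k) := by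
    intro k
    have e1 : cdeg (P, k) = k + (2 * P.wt - P.p 0) := by
      simp only [cdeg]
      have := P.wt_split
      omega
    have e2 : q ^ (k * P.p 0 + cexp ℓ (P.p 0) P.tail) * q ^ ((cdeg (P, k) + 1).choose 2) =
        q ^ (k.choose 2) * (q * q ^ (2 * P.wt)) ^ k * q ^ (en ℓ P) := by
      rw [← pow_add, ← exp_eq, ← pow_succ', ← pow_mul, ← pow_add, ← pow_add]
    have e3 : a ^ (cdeg (P, k)) = a ^ k * a ^ (2 * P.wt - P.p 0) := by rw [e1, pow_add]
    rw [cco, ww, e3, ec, mul_assoc a, mul_pow a]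
    linear_combination ((-1) ^ k * ((qP q q k)⁻¹ * (bConj q P)⁻¹) *
      (a ^ k * a ^ (2 * P.wt - P.p 0))) * e2
  simp_rw [h2]
  rw [tsum_mul_left, ← eF]
  ring

lemma main_proof (ℓ : ℕ) (q a : ℂ) (hq : ‖q‖ < 1)
    (ha : ∀ m : ℕ, 1 ≤ m → a * q ^ m ≠ 1) :
    (∑' P : Ptn,
      a ^ (2 * P.wt - P.p 0) *
        q ^ (ch2 (2 * (P.wt : ℤ) + 1) - 2 * (P.wt : ℤ) * (P.p 0 : ℤ) + 2 * (P.nConj : ℤ)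
            + (P.wt : ℤ) - (P.headSum ℓ : ℤ)) *
        ((qP q (a * q) (2 * P.wt))⁻¹ * (Ptn.bConj q P)⁻¹))
    = (qPInf q (a * q))⁻¹ *
        ∑' i : ℕ,
          (a ^ (2 * i) * q ^ (ch2 (2 * (i : ℤ) + 1))
            - a ^ (2 * i + 2 * ℓ + 1) * q ^ (ch2 (2 * (i : ℤ) + 2 * (ℓ : ℤ) + 2))) *
            (qP q q i)⁻¹ := by
  simp_rw [lhs_term hq ha]
  rw [tsum_mul_left, ← (summable_main hq a ℓ).tsum_prod, sum_formal hq]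
  congr 2; ext1 i
  have h1 := ch2_nat (2 * i + 1)
  have h2 := ch2_nat (2 * i + 2 * ℓ + 2)
  push_cast at h1 h2
  rw [h1, h2, zpow_natCast, zpow_natCast, ww, ww]

end

/-- Identity (3.25) of the paper. -/
theorem partition_a_identity (ℓ : ℕ) (q a : ℂ) (hq : ‖q‖ < 1)
    (ha : ∀ m : ℕ, 1 ≤ m → a * q ^ m ≠ 1) :
    (∑' P : Ptn,
      a ^ (2 * P.wt - P.p 0) *
        q ^ (ch2 (2 * (P.wt : ℤ) + 1) - 2 * (P.wt : ℤ) * (P.p 0 : ℤ) + 2 * (P.nConj : ℤ)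
            + (P.wt : ℤ) - (P.headSum ℓ : ℤ)) *
        ((qP q (a * q) (2 * P.wt))⁻¹ * (Ptn.bConj q P)⁻¹))
    = (qPInf q (a * q))⁻¹ *
        ∑' i : ℕ,
          (a ^ (2 * i) * q ^ (ch2 (2 * (i : ℤ) + 1))
            - a ^ (2 * i + 2 * ℓ + 1) * q ^ (ch2 (2 * (i : ℤ) + 2 * (ℓ : ℤ) + 2))) *
            (qP q q i)⁻¹ := by
  exact main_proof ℓ q a hq ha
end
end

section
/- For every integer t and complex q with |q| < 1, the non-graded parafermion Verma character admits the bosonic representation Vhat_t(q) = (q;q)_inf^{-2} sum_{i >= 0} (-1)^i q^{C(i+1,2) - i t}, i.e. sum_{j >= 0} q^{j+t} / ((q;q)_j (q;q)_{j+t}) = (q;q)_inf^{-2} sum_{i >= 0} (-1)^i q^{i(i+1)/2 - i t}. -/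
open scoped BigOperators

noncomputable section

/-- `1/(q;q)_n` for `n : ℤ`, equal to `0` for negative `n`. -/
def invQ (q : ℂ) (n : ℤ) : ℂ := if 0 ≤ n then (qP q q n.toNat)⁻¹ else 0

open Filter Topology

lemma invQ_nat (q : ℂ) (n : ℕ) : invQ q (n : ℤ) = (qP q q n)⁻¹ := by
  simp [invQ]

lemma one_sub_ne {q : ℂ} (hq : ‖q‖ < 1) (n : ℕ) : 1 - q * q ^ n ≠ 0 := by
  intro h
  have h1 : q ^ (n + 1) = 1 := by rw [pow_succ']; exact (sub_eq_zero.mp h).symm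
  have h2 : ‖q‖ ^ (n + 1) < 1 := pow_lt_one₀ (norm_nonneg _) hq (by omega)
  rw [← norm_pow, h1] at h2
  simp at h2

lemma qPinv_zero (q : ℂ) : (fun n => (qP q q n)⁻¹) 0 = 1 := by simp [qP]

lemma qPinv_succ {q : ℂ} (hq : ‖q‖ < 1) (n : ℕ) :
    (fun n => (qP q q n)⁻¹) n = (fun n => (qP q q n)⁻¹) (n + 1) * (1 - q ^ (n + 1)) := by
  have h := one_sub_ne hq n
  have e : q ^ (n + 1) = q * q ^ n := pow_succ' q n
  simp only [qP, Finset.prod_range_succ, mul_inv]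
  rw [e, mul_assoc, inv_mul_cancel₀ h, mul_one]

lemma summ_aux {q : ℂ} (hq : ‖q‖ < 1) : Summable (fun m : ℕ => ‖-(q * q ^ m)‖) := by
  simp only [norm_neg, norm_mul, norm_pow]
  exact (summable_geometric_of_lt_one (norm_nonneg _) hq).mul_left _

lemma qPinv_tendsto {q : ℂ} (hq : ‖q‖ < 1) :
    Tendsto (fun n => (qP q q n)⁻¹) atTop (𝓝 (qPInf q q)⁻¹) := by
  have hm := multipliable_one_add_of_summable (summ_aux hq)
  have hn := tprod_one_add_ne_zero_of_summable (f := fun m : ℕ => -(q * q ^ m))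
    (fun i => by rw [← sub_eq_add_neg]; exact one_sub_ne hq i) (summ_aux hq)
  have ht := hm.tendsto_prod_tprod_nat
  simp only [← sub_eq_add_neg] at hn ht
  exact ht.inv₀ hn

/-- The series `∑ q^m / ((q)_m (q)_{m+s})`. -/
def Hs (q : ℂ) (a : ℕ → ℂ) (s : ℕ) : ℂ := ∑' m : ℕ, q ^ m * (a m * a (m + s))

/-- The partial theta series. -/
def Bs (q : ℂ) (s : ℕ) : ℂ := ∑' i : ℕ, (-1 : ℂ) ^ i * q ^ (i * (i + 1) / 2 + i * s)

lemma tri_succ (i : ℕ) : (i + 1) * (i + 1 + 1) / 2 = i * (i + 1) / 2 + (i + 1) := by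
  have : (i + 1) * (i + 1 + 1) = i * (i + 1) + (i + 1) * 2 := by ring
  rw [this, Nat.add_mul_div_right _ _ (by norm_num)]

lemma le_tri (i : ℕ) : i ≤ i * (i + 1) / 2 := by
  induction i with
  | zero => simp
  | succ k ih => rw [tri_succ]; omega

lemma Bs_bound {q : ℂ} (hq : ‖q‖ < 1) (s i : ℕ) :
    ‖(-1 : ℂ) ^ i * q ^ (i * (i + 1) / 2 + i * s)‖ ≤ ‖q‖ ^ i := by
  rw [norm_mul, norm_pow, norm_neg, norm_one, one_pow, one_mul, norm_pow]
  exact pow_le_pow_of_le_one (norm_nonneg _) hq.le ((le_tri i).trans (Nat.le_add_right _ _))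

lemma Bs_summable {q : ℂ} (hq : ‖q‖ < 1) (s : ℕ) :
    Summable (fun i : ℕ => (-1 : ℂ) ^ i * q ^ (i * (i + 1) / 2 + i * s)) :=
  Summable.of_norm_bounded (summable_geometric_of_lt_one (norm_nonneg _) hq) (Bs_bound hq s)

lemma Bs_norm {q : ℂ} (hq : ‖q‖ < 1) (s : ℕ) : ‖Bs q s‖ ≤ (1 - ‖q‖)⁻¹ :=
  tsum_of_norm_bounded (hasSum_geometric_of_lt_one (norm_nonneg _) hq) (Bs_bound hq s)

lemma Bs_rec {q : ℂ} (hq : ‖q‖ < 1) (s : ℕ) : Bs q s = 1 - q ^ (s + 1) * Bs q (s + 1) := by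
  rw [Bs, (Bs_summable hq s).tsum_eq_zero_add, Bs, ← tsum_mul_left, sub_eq_add_neg, ← tsum_neg]
  congr 1
  · simp
  · refine tsum_congr fun i => ?_
    rw [tri_succ]
    ring

lemma tri_cast (i : ℕ) : (i : ℤ) * ((i : ℤ) + 1) / 2 = ((i * (i + 1) / 2 : ℕ) : ℤ) := by
  push_cast; rfl

lemma Bs_neg (q : ℂ) (s : ℕ) :
    ∑' i : ℕ, (-1 : ℂ) ^ i * q ^ ((i : ℤ) * ((i : ℤ) + 1) / 2 - (i : ℤ) * (-(s : ℤ))) = Bs q s := by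
  refine tsum_congr fun i => ?_
  rw [tri_cast, ← zpow_natCast q]
  congr 2
  push_cast
  ring

lemma tri_two (i : ℤ) : 2 * (i * (i + 1) / 2) = i * (i + 1) :=
  Int.mul_ediv_cancel' (Int.even_mul_succ_self i).two_dvd

lemma Bs_pos {q : ℂ} (hq : ‖q‖ < 1) (s : ℕ) :
    ∑' i : ℕ, (-1 : ℂ) ^ i * q ^ ((i : ℤ) * ((i : ℤ) + 1) / 2 - (i : ℤ) * (s : ℤ))
      = q ^ s * Bs q s := by
  set f : ℕ → ℂ := fun i =>
    (-1 : ℂ) ^ i * q ^ ((i : ℤ) * ((i : ℤ) + 1) / 2 - (i : ℤ) * (s : ℤ)) with hf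
  have hshift : ∀ k : ℕ, f (k + 2 * s) =
      q ^ s * ((-1 : ℂ) ^ k * q ^ (k * (k + 1) / 2 + k * s)) := by
    intro k
    have e : (((k + 2 * s : ℕ) : ℤ) * (((k + 2 * s : ℕ) : ℤ) + 1) / 2
        - ((k + 2 * s : ℕ) : ℤ) * (s : ℤ)) = ((s + (k * (k + 1) / 2 + k * s) : ℕ) : ℤ) := by
      have h1 := tri_two ((k + 2 * s : ℕ) : ℤ)
      have h2 := tri_two (k : ℤ)
      push_cast at h1 h2 ⊢
      linarith
    simp only [hf]
    rw [e, zpow_natCast, pow_add (-1 : ℂ), pow_mul, pow_add q s]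
    simp
    ring
  have hsum : Summable (fun k => f (k + 2 * s)) := by
    simp only [hshift]
    exact (Bs_summable hq s).mul_left _
  have hzero : ∑ i ∈ Finset.range (2 * s), f i = 0 := by
    have h := Finset.sum_range_reflect f (2 * s)
    have h2 : ∑ i ∈ Finset.range (2 * s), f (2 * s - 1 - i)
        = ∑ i ∈ Finset.range (2 * s), -f i := by
      refine Finset.sum_congr rfl fun i hi => ?_
      have hi' := Finset.mem_range.mp hi
      obtain ⟨j, hj⟩ : ∃ j, j + i + 1 = 2 * s := ⟨2 * s - 1 - i, by omega⟩
      have hjj : 2 * s - 1 - i = j := by omega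
      rw [hjj]
      simp only [hf]
      have e : (j : ℤ) * ((j : ℤ) + 1) / 2 - (j : ℤ) * (s : ℤ)
          = (i : ℤ) * ((i : ℤ) + 1) / 2 - (i : ℤ) * (s : ℤ) := by
        have h1 := tri_two (j : ℤ)
        have h2 := tri_two (i : ℤ)
        have h3 : (j : ℤ) = 2 * s - 1 - i := by omega
        have h4 : (j : ℤ) * ((j : ℤ) + 1) - 2 * ((j : ℤ) * (s : ℤ))
          = (i : ℤ) * ((i : ℤ) + 1) - 2 * ((i : ℤ) * (s : ℤ)) := by rw [h3]; ring
        linarith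
      have sg : (-1 : ℂ) ^ j = -(-1 : ℂ) ^ i := by
        have h5 : (-1 : ℂ) ^ (j + i + 1) = 1 := by rw [hj, pow_mul]; simp
        have h6 : (-1 : ℂ) ^ i * (-1 : ℂ) ^ i = 1 := by rw [← mul_pow]; simp
        rw [pow_succ, pow_add] at h5
        linear_combination (-(-1 : ℂ) ^ i) * h5 - (-1 : ℂ) ^ j * h6
      rw [e, sg, neg_mul]
    rw [h2, Finset.sum_neg_distrib] at h
    exact self_eq_neg.mp h.symm
  rw [← hsum.sum_add_tsum_nat_add', hzero, zero_add, Bs, ← tsum_mul_left]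
  exact tsum_congr hshift

section
variable {q : ℂ} {a : ℕ → ℂ} {L : ℂ}

lemma a_bound (hL : Tendsto a atTop (𝓝 L)) : ∃ M : ℝ, 0 ≤ M ∧ ∀ n, ‖a n‖ ≤ M := by
  obtain ⟨M, hM⟩ := (Metric.isBounded_range_of_tendsto a hL).exists_norm_le
  have h : ∀ n, ‖a n‖ ≤ M := fun n => hM _ ⟨n, rfl⟩
  exact ⟨M, (norm_nonneg _).trans (h 0), h⟩

lemma Hs_bound {M : ℝ} (hM0 : 0 ≤ M) (hM : ∀ n, ‖a n‖ ≤ M) (s m : ℕ) :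
    ‖q ^ m * (a m * a (m + s))‖ ≤ M * M * ‖q‖ ^ m := by
  rw [norm_mul, norm_mul, norm_pow, mul_comm]
  have := mul_le_mul (hM m) (hM (m + s)) (norm_nonneg _) hM0
  gcongr

lemma Hs_summable (hq : ‖q‖ < 1) (hL : Tendsto a atTop (𝓝 L)) (s : ℕ) :
    Summable (fun m : ℕ => q ^ m * (a m * a (m + s))) := by
  obtain ⟨M, hM0, hM⟩ := a_bound hL
  exact Summable.of_norm_bounded
    ((summable_geometric_of_lt_one (norm_nonneg _) hq).mul_left _) (Hs_bound hM0 hM s)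

lemma Hs_step (hq : ‖q‖ < 1) (h0 : a 0 = 1) (h1 : ∀ n, a n = a (n + 1) * (1 - q ^ (n + 1)))
    (hL : Tendsto a atTop (𝓝 L)) (s : ℕ) :
    Hs q a s + q ^ (s + 1) * Hs q a (s + 1)
      = Hs q a (s + 1) + q ^ (s + 2) * Hs q a (s + 2) := by
  have S := Hs_summable hq hL
  -- shifted sum
  have hA : ∀ m, q ^ m * (a m * a (m + s)) + q ^ (s + 1) * (q ^ m * (a m * a (m + (s + 1))))
      - q ^ m * (a m * a (m + (s + 1)))
      = q ^ (s + 1) * (q ^ m * (1 - q ^ m) * (a m * a (m + (s + 1)))) := by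
    intro m
    rw [h1 (m + s), ← add_assoc m s 1]
    ring
  have hs : Summable (fun m : ℕ => q ^ (s + 1) * (q ^ m * (1 - q ^ m) * (a m * a (m + (s + 1))))) := by
    simp only [← hA]
    exact ((S s).add ((S (s + 1)).mul_left _)).sub (S (s + 1))
  have e1 : Hs q a s + q ^ (s + 1) * Hs q a (s + 1) - Hs q a (s + 1)
      = ∑' m : ℕ, q ^ (s + 1) * (q ^ m * (1 - q ^ m) * (a m * a (m + (s + 1)))) := by
    simp only [← hA]
    rw [((S s).add ((S (s + 1)).mul_left _)).tsum_sub (S (s + 1)),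
      (S s).tsum_add ((S (s + 1)).mul_left _), tsum_mul_left]
    rfl
  have e2 : ∑' m : ℕ, q ^ (s + 1) * (q ^ m * (1 - q ^ m) * (a m * a (m + (s + 1))))
      = q ^ (s + 2) * Hs q a (s + 2) := by
    rw [hs.tsum_eq_zero_add, Hs, ← tsum_mul_left]
    simp only [pow_zero, sub_self, mul_zero, zero_mul, zero_add]
    refine tsum_congr fun m => ?_
    have e : m + 1 + (s + 1) = m + (s + 2) := by ring
    rw [h1 m, e]
    ring
  linear_combination e1 + e2

lemma sum_qa (hq : ‖q‖ < 1) (h0 : a 0 = 1) (h1 : ∀ n, a n = a (n + 1) * (1 - q ^ (n + 1)))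
    (hL : Tendsto a atTop (𝓝 L)) : ∑' m : ℕ, q ^ m * a m = L := by
  obtain ⟨M, hM0, hM⟩ := a_bound hL
  have hs : Summable (fun m : ℕ => q ^ m * a m) := by
    refine Summable.of_norm_bounded
      ((summable_geometric_of_lt_one (norm_nonneg _) hq).mul_left M) fun m => ?_
    rw [norm_mul, norm_pow, mul_comm]
    gcongr
    exact hM m
  have hp : ∀ n, ∑ m ∈ Finset.range (n + 1), q ^ m * a m = a n := by
    intro n
    induction n with
    | zero => simp [h0]
    | succ k ih => rw [Finset.sum_range_succ, ih, h1 k]; ring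
  have ht := (tendsto_add_atTop_iff_nat 1).mpr hs.tendsto_sum_tsum_nat
  simp only [hp] at ht
  exact tendsto_nhds_unique ht hL

lemma Hs_lim (hq : ‖q‖ < 1) (h0 : a 0 = 1) (h1 : ∀ n, a n = a (n + 1) * (1 - q ^ (n + 1)))
    (hL : Tendsto a atTop (𝓝 L)) : Tendsto (Hs q a) atTop (𝓝 (L ^ 2)) := by
  obtain ⟨M, hM0, hM⟩ := a_bound hL
  have e : L ^ 2 = ∑' m : ℕ, q ^ m * (a m * L) := by
    simp only [← mul_assoc]
    rw [tsum_mul_right, sum_qa hq h0 h1 hL, sq]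
  rw [e]
  refine tendsto_tsum_of_dominated_convergence (bound := fun m => M * M * ‖q‖ ^ m)
    ((summable_geometric_of_lt_one (norm_nonneg _) hq).mul_left _) (fun m => ?_)
    (Eventually.of_forall fun s m => Hs_bound hM0 hM s m)
  have : Tendsto (fun s => a (m + s)) atTop (𝓝 L) := by
    simp only [add_comm m]
    exact (tendsto_add_atTop_iff_nat m).mpr hL
  exact (this.const_mul _).const_mul _

lemma Hs_rec (hq : ‖q‖ < 1) (h0 : a 0 = 1) (h1 : ∀ n, a n = a (n + 1) * (1 - q ^ (n + 1)))
    (hL : Tendsto a atTop (𝓝 L)) (s : ℕ) :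
    Hs q a s + q ^ (s + 1) * Hs q a (s + 1) = L ^ 2 := by
  have hl := Hs_lim hq h0 h1 hL
  have hc : ∀ n, Hs q a (s + n) + q ^ (s + n + 1) * Hs q a (s + n + 1)
      = Hs q a s + q ^ (s + 1) * Hs q a (s + 1) := by
    intro n
    induction n with
    | zero => rfl
    | succ k ih =>
      rw [← ih, Hs_step hq h0 h1 hL (s + k)]
      rfl
  have hq0 : Tendsto (fun n : ℕ => q ^ n) atTop (𝓝 0) := tendsto_pow_atTop_nhds_zero_of_norm_lt_one hq
  have ht : Tendsto (fun n => Hs q a n + q ^ (n + 1) * Hs q a (n + 1)) atTop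
      (𝓝 (L ^ 2 + 0 * L ^ 2)) :=
    hl.add (((tendsto_add_atTop_iff_nat 1).mpr hq0).mul ((tendsto_add_atTop_iff_nat 1).mpr hl))
  have ht2 := (tendsto_add_atTop_iff_nat s).mpr ht
  simp only [add_comm _ s, hc] at ht2
  have := tendsto_nhds_unique ht2 tendsto_const_nhds
  rw [← this]
  ring

lemma Hs_eq (hq : ‖q‖ < 1) (h0 : a 0 = 1) (h1 : ∀ n, a n = a (n + 1) * (1 - q ^ (n + 1)))
    (hL : Tendsto a atTop (𝓝 L)) (s : ℕ) : Hs q a s = L ^ 2 * Bs q s := by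
  obtain ⟨K, hK⟩ := (Metric.isBounded_range_of_tendsto _ (Hs_lim hq h0 h1 hL)).exists_norm_le
  have hD : ∀ n, Hs q a n - L ^ 2 * Bs q n
      = -(q ^ (n + 1) * (Hs q a (n + 1) - L ^ 2 * Bs q (n + 1))) := by
    intro n
    linear_combination Hs_rec hq h0 h1 hL n - L ^ 2 * Bs_rec hq n
  set C : ℝ := K + ‖L ^ 2‖ * (1 - ‖q‖)⁻¹ with hC
  have hb : ∀ n, ‖Hs q a n - L ^ 2 * Bs q n‖ ≤ C := by
    intro n
    refine (norm_sub_le _ _).trans (add_le_add (hK _ ⟨n, rfl⟩) ?_)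
    rw [norm_mul]
    exact mul_le_mul_of_nonneg_left (Bs_norm hq n) (norm_nonneg _)
  have hb2 : ∀ k n, ‖Hs q a n - L ^ 2 * Bs q n‖ ≤ ‖q‖ ^ k * C := by
    intro k
    induction k with
    | zero => simpa using hb
    | succ k ih =>
      intro n
      rw [hD n, norm_neg, norm_mul, norm_pow, pow_succ' ‖q‖ k, mul_assoc]
      refine mul_le_mul ?_ (ih _) (norm_nonneg _) (norm_nonneg _)
      exact pow_le_of_le_one (norm_nonneg _) hq.le (by omega)
  have hlim : Tendsto (fun k : ℕ => ‖q‖ ^ k * C) atTop (𝓝 (0 * C)) :=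
    (tendsto_pow_atTop_nhds_zero_of_lt_one (norm_nonneg _) hq).mul_const C
  rw [zero_mul] at hlim
  have h := ge_of_tendsto' hlim (fun k => hb2 k s)
  exact sub_eq_zero.mp (norm_le_zero_iff.mp h)

end

/-- Bosonic form of the non-graded parafermion Verma character. -/
theorem nongraded_verma_bosonic (t : ℤ) (q : ℂ) (hq : ‖q‖ < 1) :
    (∑' j : ℕ, q ^ ((j : ℤ) + t) * ((qP q q j)⁻¹ * invQ q ((j : ℤ) + t)))
    = ((qPInf q q)⁻¹) ^ 2 *
        ∑' i : ℕ, (-1 : ℂ) ^ i * q ^ ((i : ℤ) * ((i : ℤ) + 1) / 2 - (i : ℤ) * t) := by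
  have key : ∀ s : ℕ, Hs q (fun n => (qP q q n)⁻¹) s = ((qPInf q q)⁻¹) ^ 2 * Bs q s := fun s =>
    Hs_eq hq (qPinv_zero q) (qPinv_succ hq) (qPinv_tendsto hq) s
  rcases le_total 0 t with ht | ht
  · obtain ⟨s, rfl⟩ := Int.eq_ofNat_of_zero_le ht
    rw [Bs_pos hq, mul_left_comm, ← key, Hs, ← tsum_mul_left]
    refine tsum_congr fun j => ?_
    have h1 : ((j : ℤ) + (s : ℤ)) = ((j + s : ℕ) : ℤ) := by push_cast; ring
    rw [h1, zpow_natCast, invQ_nat]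
    ring
  · obtain ⟨s, hs⟩ := Int.eq_ofNat_of_zero_le (neg_nonneg.mpr ht)
    obtain rfl : t = -(s : ℤ) := by omega
    rw [Bs_neg, ← key, Hs]
    have hinj : Function.Injective (fun m : ℕ => m + s) := add_left_injective s
    rw [← hinj.tsum_eq]
    · refine tsum_congr fun m => ?_
      have h1 : (((m + s : ℕ) : ℤ) + -(s : ℤ)) = ((m : ℕ) : ℤ) := by push_cast; ring
      simp only [h1, zpow_natCast, invQ_nat]
      ring
    · intro j hj
      by_contra hne
      have hlt : j < s := by
        by_contra hge
        exact hne ⟨j - s, by simp; omega⟩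
      apply hj
      have : ¬ (0 ≤ (j : ℤ) + -(s : ℤ)) := by omega
      simp [invQ, this]
end
end
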